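/- arXiv:1306.3897 — 3 statements merged into one kernel-verified Lean document; each statement's English description precedes it below -/
import Mathlib

section
/- Let (M,g) be a smooth Riemannian manifold and f a smooth function on M. Then at every point of M one has (1/2) Δ|∇f|² = Rc(∇f, ∇f) + |∇²f|² + ⟨∇f, ∇(Δf)⟩, where Δ = div ∘ ∇ is the Laplace–Beltrami operator, ∇²f is the Hessian of f, |∇²f|² its squared Hilbert–Schmidt norm, and Rc is the Ricci curvature. -/
/-!
We formalize Riemannian geometry on a coordinate chart: a Riemannian metric on an open
subset of `ℝⁿ` is given by a smooth field of positive definite symmetric matrices `g`.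
All of the classical objects (Levi-Civita connection via Christoffel symbols, curvature,
Ricci curvature, gradient, Hessian, Laplace–Beltrami operator, divergence, covariant
derivatives of vector fields) are defined below by their standard coordinate formulas.
-/

open scoped BigOperators
open Matrix MeasureTheory

noncomputable section

/-- `i`-th partial derivative of a scalar function on `ℝⁿ`. -/
def pd {n : ℕ} (i : Fin n) (h : (Fin n → ℝ) → ℝ) (x : Fin n → ℝ) : ℝ :=
  fderiv ℝ h x (Pi.single i 1)

/-- Directional derivative of the scalar function `h` at `x` in the direction of the
tangent vector `v` (i.e. `v(h)` at `x`). -/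
def dirDeriv {n : ℕ} (v : Fin n → ℝ) (h : (Fin n → ℝ) → ℝ) (x : Fin n → ℝ) : ℝ :=
  fderiv ℝ h x v

/-- The inner product `⟨v, w⟩` of the tangent vectors `v`, `w` at the point `x`,
with respect to the metric `g`. -/
def gip {n : ℕ} (g : (Fin n → ℝ) → Matrix (Fin n) (Fin n) ℝ) (x v w : Fin n → ℝ) : ℝ :=
  ∑ i, ∑ j, g x i j * v i * w j

/-- `g` is a (smooth) Riemannian metric on the set `U ⊆ ℝⁿ`: a smooth field of
symmetric positive definite matrices. -/
def IsRiemannianMetricOn {n : ℕ} (g : (Fin n → ℝ) → Matrix (Fin n) (Fin n) ℝ)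
    (U : Set (Fin n → ℝ)) : Prop :=
  (∀ i j, ContDiffOn ℝ (⊤ : ℕ∞) (fun x => g x i j) U) ∧ ∀ x ∈ U, (g x).PosDef

/-- Christoffel symbols `Γ^k_{ij}` of the Levi-Civita connection of the metric `g`. -/
def christoffel {n : ℕ} (g : (Fin n → ℝ) → Matrix (Fin n) (Fin n) ℝ) (k i j : Fin n)
    (x : Fin n → ℝ) : ℝ :=
  (1 / 2) * ∑ l, (g x)⁻¹ k l *
    (pd i (fun y => g y j l) x + pd j (fun y => g y i l) x - pd l (fun y => g y i j) x)

/-- Components `R^l_{ijk}` of the Riemann curvature tensor of `g`, so that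
`R(∂ᵢ,∂ⱼ)∂ₖ = ∑ l, R^l_{ijk} ∂_l` where `R(X,Y)Z = ∇_X ∇_Y Z - ∇_Y ∇_X Z - ∇_[X,Y] Z`. -/
def riemann {n : ℕ} (g : (Fin n → ℝ) → Matrix (Fin n) (Fin n) ℝ) (l i j k : Fin n)
    (x : Fin n → ℝ) : ℝ :=
  pd i (christoffel g l j k) x - pd j (christoffel g l i k) x
    + ∑ m, (christoffel g l i m x * christoffel g m j k x
        - christoffel g l j m x * christoffel g m i k x)

/-- The Ricci curvature `Rc(v,w)` at `x`, for tangent vectors `v`, `w`: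
`Rc(Y,Z) = tr (W ↦ R(W,Y)Z)`. -/
def ricci {n : ℕ} (g : (Fin n → ℝ) → Matrix (Fin n) (Fin n) ℝ) (x v w : Fin n → ℝ) : ℝ :=
  ∑ i, ∑ j, (∑ k, riemann g k k i j x) * v i * w j

/-- The covariant derivative `∇_v V` at `x` of the vector field `V` in the
direction of the tangent vector `v` at `x`. -/
def covDeriv {n : ℕ} (g : (Fin n → ℝ) → Matrix (Fin n) (Fin n) ℝ)
    (V : (Fin n → ℝ) → Fin n → ℝ) (v : Fin n → ℝ) (x : Fin n → ℝ) : Fin n → ℝ :=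
  fun k => (∑ i, v i * pd i (fun y => V y k) x)
    + ∑ i, ∑ j, christoffel g k i j x * v i * V x j

/-- The divergence `div V = tr (Y ↦ ∇_Y V)` of the vector field `V`. -/
def divVF {n : ℕ} (g : (Fin n → ℝ) → Matrix (Fin n) (Fin n) ℝ)
    (V : (Fin n → ℝ) → Fin n → ℝ) (x : Fin n → ℝ) : ℝ :=
  ∑ k, covDeriv g V (Pi.single k 1) x k

/-- The gradient `∇f` of a scalar function `f`, with respect to the metric `g`. -/
def grad {n : ℕ} (g : (Fin n → ℝ) → Matrix (Fin n) (Fin n) ℝ) (f : (Fin n → ℝ) → ℝ)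
    (x : Fin n → ℝ) : Fin n → ℝ :=
  fun i => ∑ j, (g x)⁻¹ i j * pd j f x

/-- `|∇f|²` at `x`. -/
def gradNormSq {n : ℕ} (g : (Fin n → ℝ) → Matrix (Fin n) (Fin n) ℝ) (f : (Fin n → ℝ) → ℝ)
    (x : Fin n → ℝ) : ℝ :=
  gip g x (grad g f x) (grad g f x)

/-- The components `(∇²f)_{ij}` of the Hessian of `f`. -/
def hessC {n : ℕ} (g : (Fin n → ℝ) → Matrix (Fin n) (Fin n) ℝ) (f : (Fin n → ℝ) → ℝ)
    (i j : Fin n) (x : Fin n → ℝ) : ℝ :=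
  pd i (pd j f) x - ∑ k, christoffel g k i j x * pd k f x

/-- The Hessian `∇²f(v,w) = ⟨∇_v ∇f, w⟩` evaluated on tangent vectors `v`, `w` at `x`. -/
def hess {n : ℕ} (g : (Fin n → ℝ) → Matrix (Fin n) (Fin n) ℝ) (f : (Fin n → ℝ) → ℝ)
    (x v w : Fin n → ℝ) : ℝ :=
  ∑ i, ∑ j, hessC g f i j x * v i * w j

/-- The Laplace–Beltrami operator `Δf = div (∇ f) = tr_g ∇²f`. -/
def lap {n : ℕ} (g : (Fin n → ℝ) → Matrix (Fin n) (Fin n) ℝ) (f : (Fin n → ℝ) → ℝ)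
    (x : Fin n → ℝ) : ℝ :=
  ∑ i, ∑ j, (g x)⁻¹ i j * hessC g f i j x

/-- The squared Hilbert–Schmidt norm `|∇²f|²` of the Hessian of `f`. -/
def hessNormSq {n : ℕ} (g : (Fin n → ℝ) → Matrix (Fin n) (Fin n) ℝ) (f : (Fin n → ℝ) → ℝ)
    (x : Fin n → ℝ) : ℝ :=
  ∑ i, ∑ j, ∑ k, ∑ l,
    (g x)⁻¹ i k * (g x)⁻¹ j l * hessC g f i j x * hessC g f k l x

/-- The vector field `X = ∇f / |∇f|²`. -/
def vecX {n : ℕ} (g : (Fin n → ℝ) → Matrix (Fin n) (Fin n) ℝ) (f : (Fin n → ℝ) → ℝ)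
    (x : Fin n → ℝ) : Fin n → ℝ :=
  fun i => grad g f x i / gradNormSq g f x

/-- `|X|²` for `X = ∇f / |∇f|²`. -/
def xNormSq {n : ℕ} (g : (Fin n → ℝ) → Matrix (Fin n) (Fin n) ℝ) (f : (Fin n → ℝ) → ℝ)
    (x : Fin n → ℝ) : ℝ :=
  gip g x (vecX g f x) (vecX g f x)

end

section BochnerHelpers

variable {n : ℕ} {U : Set (Fin n → ℝ)} {x : Fin n → ℝ}

lemma sm_diffAt (hU : IsOpen U) {a : (Fin n → ℝ) → ℝ} (ha : ContDiffOn ℝ (⊤ : ℕ∞) a U)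
    (hx : x ∈ U) : DifferentiableAt ℝ a x :=
  (ha.differentiableOn (by simp)).differentiableAt (hU.mem_nhds hx)

lemma sm_pd (hU : IsOpen U) {a : (Fin n → ℝ) → ℝ} (ha : ContDiffOn ℝ (⊤ : ℕ∞) a U)
    (i : Fin n) : ContDiffOn ℝ (⊤ : ℕ∞) (pd i a) U := by
  have h := ha.fderiv_of_isOpen (m := ((⊤ : ℕ∞) : WithTop ℕ∞)) hU (by simp)
  exact h.clm_apply contDiffOn_const

lemma pd_congr' (hU : IsOpen U) {a b : (Fin n → ℝ) → ℝ} (hab : ∀ y ∈ U, a y = b y)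
    (hx : x ∈ U) (i : Fin n) : pd i a x = pd i b x := by
  unfold pd
  rw [Filter.EventuallyEq.fderiv_eq]
  filter_upwards [hU.mem_nhds hx] with y hy using hab y hy

lemma pd_mul' {a b : (Fin n → ℝ) → ℝ} (ha : DifferentiableAt ℝ a x)
    (hb : DifferentiableAt ℝ b x) (i : Fin n) :
    pd i (fun y => a y * b y) x = pd i a x * b x + a x * pd i b x := by
  unfold pd
  rw [fderiv_fun_mul ha hb]
  simp
  ring

lemma pd_add' {a b : (Fin n → ℝ) → ℝ} (ha : DifferentiableAt ℝ a x)
    (hb : DifferentiableAt ℝ b x) (i : Fin n) :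
    pd i (fun y => a y + b y) x = pd i a x + pd i b x := by
  unfold pd
  rw [fderiv_fun_add ha hb]
  simp

lemma pd_sub' {a b : (Fin n → ℝ) → ℝ} (ha : DifferentiableAt ℝ a x)
    (hb : DifferentiableAt ℝ b x) (i : Fin n) :
    pd i (fun y => a y - b y) x = pd i a x - pd i b x := by
  unfold pd
  rw [fderiv_fun_sub ha hb]
  simp

lemma pd_neg' {a : (Fin n → ℝ) → ℝ} (i : Fin n) :
    pd i (fun y => - a y) x = - pd i a x := by
  unfold pd
  rw [fderiv_fun_neg]
  simp

lemma pd_const' (c : ℝ) (i : Fin n) : pd i (fun _ => c) x = 0 := by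
  unfold pd
  simp

lemma pd_sum' {ι : Type*} [Fintype ι] {a : ι → (Fin n → ℝ) → ℝ}
    (ha : ∀ j, DifferentiableAt ℝ (a j) x) (i : Fin n) :
    pd i (fun y => ∑ j, a j y) x = ∑ j, pd i (a j) x := by
  unfold pd
  rw [fderiv_fun_sum (fun j _ => ha j)]
  simp

lemma pd_comm' (hU : IsOpen U) {a : (Fin n → ℝ) → ℝ} (ha : ContDiffOn ℝ (⊤ : ℕ∞) a U)
    (hx : x ∈ U) (i j : Fin n) : pd i (pd j a) x = pd j (pd i a) x := by
  have hc : ContDiffAt ℝ (⊤ : ℕ∞) a x := ha.contDiffAt (hU.mem_nhds hx)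
  have hs : IsSymmSndFDerivAt ℝ a x := hc.isSymmSndFDerivAt (by
    simp only [minSmoothness_of_isRCLikeNormedField]
    exact WithTop.coe_le_coe.2 (le_top : (2 : ℕ∞) ≤ ⊤))
  have hd : DifferentiableAt ℝ (fderiv ℝ a) x :=
    ((ha.fderiv_of_isOpen (m := ((⊤ : ℕ∞) : WithTop ℕ∞)) hU (by simp)).differentiableOn
      (by simp)).differentiableAt (hU.mem_nhds hx)
  have key : ∀ k l : Fin n, pd k (pd l a) x
      = fderiv ℝ (fderiv ℝ a) x (Pi.single k 1) (Pi.single l 1) := by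
    intro k l
    have : pd k (pd l a) x
      = fderiv ℝ (fun y => (fderiv ℝ a y) (Pi.single l 1)) x (Pi.single k 1) := rfl
    rw [this, fderiv_clm_apply hd (by fun_prop)]
    simp
  rw [key, key]
  exact hs _ _

lemma sm_inv {g : (Fin n → ℝ) → Matrix (Fin n) (Fin n) ℝ}
    (hg : IsRiemannianMetricOn g U) (i j : Fin n) :
    ContDiffOn ℝ (⊤ : ℕ∞) (fun y => (g y)⁻¹ i j) U := by
  have hdet : ∀ (m : (Fin n → ℝ) → Matrix (Fin n) (Fin n) ℝ),
      (∀ i j, ContDiffOn ℝ (⊤ : ℕ∞) (fun y => m y i j) U) →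
      ContDiffOn ℝ (⊤ : ℕ∞) (fun y => (m y).det) U := by
    intro m hm
    simp only [Matrix.det_apply']
    refine ContDiffOn.sum fun s _ => contDiffOn_const.mul ?_
    exact contDiffOn_prod fun k _ => hm _ _
  have h1 : (fun y => (g y)⁻¹ i j) = fun y => ((g y).det)⁻¹ * (g y).adjugate i j := by
    funext y
    rw [Matrix.inv_def, Ring.inverse_eq_inv']
    simp
  rw [h1]
  refine ContDiffOn.mul ((hdet g hg.1).inv fun y hy => ((hg.2 y hy).det_pos).ne') ?_
  simp only [Matrix.adjugate_apply]
  refine hdet _ fun k l => ?_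
  by_cases hk : k = j
  · subst hk
    simp only [Matrix.updateRow_self]
    exact contDiffOn_const
  · simp only [Matrix.updateRow_ne hk]
    exact hg.1 k l

lemma sm_chr (hU : IsOpen U) {g : (Fin n → ℝ) → Matrix (Fin n) (Fin n) ℝ}
    (hg : IsRiemannianMetricOn g U) (k i j : Fin n) :
    ContDiffOn ℝ (⊤ : ℕ∞) (christoffel g k i j) U := by
  unfold christoffel
  refine contDiffOn_const.mul (ContDiffOn.sum fun l _ => (sm_inv hg k l).mul ?_)
  exact ((sm_pd hU (hg.1 _ _) _).add (sm_pd hU (hg.1 _ _) _)).sub (sm_pd hU (hg.1 _ _) _)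

lemma sm_hess (hU : IsOpen U) {g : (Fin n → ℝ) → Matrix (Fin n) (Fin n) ℝ}
    (hg : IsRiemannianMetricOn g U) {f : (Fin n → ℝ) → ℝ}
    (hf : ContDiffOn ℝ (⊤ : ℕ∞) f U) (i j : Fin n) :
    ContDiffOn ℝ (⊤ : ℕ∞) (hessC g f i j) U := by
  unfold hessC
  exact (sm_pd hU (sm_pd hU hf _) _).sub
    (ContDiffOn.sum fun l _ => (sm_chr hU hg _ _ _).mul (sm_pd hU hf _))

lemma sm_grad (hU : IsOpen U) {g : (Fin n → ℝ) → Matrix (Fin n) (Fin n) ℝ}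
    (hg : IsRiemannianMetricOn g U) {f : (Fin n → ℝ) → ℝ}
    (hf : ContDiffOn ℝ (⊤ : ℕ∞) f U) (i : Fin n) :
    ContDiffOn ℝ (⊤ : ℕ∞) (fun y => grad g f y i) U := by
  unfold grad
  exact ContDiffOn.sum fun l _ => (sm_inv hg _ _).mul (sm_pd hU hf _)

lemma g_symm {g : (Fin n → ℝ) → Matrix (Fin n) (Fin n) ℝ}
    (hg : IsRiemannianMetricOn g U) (hx : x ∈ U) (i j : Fin n) : g x i j = g x j i := by
  have := (hg.2 x hx).isHermitian.apply j i
  simpa using this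

lemma inv_symm' {g : (Fin n → ℝ) → Matrix (Fin n) (Fin n) ℝ}
    (hg : IsRiemannianMetricOn g U) (hx : x ∈ U) (i j : Fin n) :
    (g x)⁻¹ i j = (g x)⁻¹ j i := by
  have := (hg.2 x hx).isHermitian.inv.apply j i
  simpa using this

lemma g_unit {g : (Fin n → ℝ) → Matrix (Fin n) (Fin n) ℝ}
    (hg : IsRiemannianMetricOn g U) (hx : x ∈ U) : IsUnit (g x).det :=
  ((hg.2 x hx).det_pos).ne'.isUnit

lemma chr_symm (hU : IsOpen U) {g : (Fin n → ℝ) → Matrix (Fin n) (Fin n) ℝ}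
    (hg : IsRiemannianMetricOn g U) (hx : x ∈ U) (k i j : Fin n) :
    christoffel g k i j x = christoffel g k j i x := by
  unfold christoffel
  congr 1
  refine Finset.sum_congr rfl fun l _ => ?_
  rw [pd_congr' hU (a := fun y => g y i j) (b := fun y => g y j i)
    (fun y hy => g_symm hg hy i j) hx]
  ring

lemma hess_symm (hU : IsOpen U) {g : (Fin n → ℝ) → Matrix (Fin n) (Fin n) ℝ}
    (hg : IsRiemannianMetricOn g U) {f : (Fin n → ℝ) → ℝ}
    (hf : ContDiffOn ℝ (⊤ : ℕ∞) f U) (hx : x ∈ U) (i j : Fin n) :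
    hessC g f i j x = hessC g f j i x := by
  unfold hessC
  rw [pd_comm' hU hf hx]
  congr 1
  exact Finset.sum_congr rfl fun l _ => by rw [chr_symm hU hg hx]

/-- Derivative of the inverse metric. -/
lemma pd_inv (hU : IsOpen U) {g : (Fin n → ℝ) → Matrix (Fin n) (Fin n) ℝ}
    (hg : IsRiemannianMetricOn g U) (hx : x ∈ U) (k i j : Fin n) :
    pd k (fun y => (g y)⁻¹ i j) x
      = - ∑ a, ∑ b, (g x)⁻¹ i a * (g x)⁻¹ j b * pd k (fun y => g y a b) x := by
  have h0 : ∀ b, ∑ a, (pd k (fun y => (g y)⁻¹ i a) x * g x a b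
      + (g x)⁻¹ i a * pd k (fun y => g y a b) x) = 0 := by
    intro b
    have h1 : pd k (fun y => ∑ a, (g y)⁻¹ i a * g y a b) x
        = pd k (fun _ => (1 : Matrix (Fin n) (Fin n) ℝ) i b) x := by
      refine pd_congr' hU (fun y hy => ?_) hx k
      rw [← Matrix.nonsing_inv_mul _ (g_unit hg hy), Matrix.mul_apply]
    rw [pd_const', pd_sum' (fun a => (sm_diffAt hU (sm_inv hg i a) hx).fun_mul
      (sm_diffAt hU (hg.1 a b) hx))] at h1
    rw [← h1]
    exact Finset.sum_congr rfl fun a _ =>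
      (pd_mul' (sm_diffAt hU (sm_inv hg i a) hx) (sm_diffAt hU (hg.1 a b) hx) k).symm
  let D : Matrix (Fin n) (Fin n) ℝ := Matrix.of fun p q => pd k (fun y => (g y)⁻¹ p q) x
  let E : Matrix (Fin n) (Fin n) ℝ := Matrix.of fun p q => pd k (fun y => g y p q) x
  have hc : ∑ b, (∑ a, (pd k (fun y => (g y)⁻¹ i a) x * g x a b
      + (g x)⁻¹ i a * pd k (fun y => g y a b) x)) * (g x)⁻¹ b j = 0 := by
    simp [h0]
  have h2 : (D * g x * (g x)⁻¹) i j = D i j := by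
    rw [Matrix.mul_assoc, Matrix.mul_nonsing_inv _ (g_unit hg hx), Matrix.mul_one]
  have h3 : (D * g x * (g x)⁻¹) i j + ((g x)⁻¹ * E * (g x)⁻¹) i j = 0 := by
    rw [← hc]
    simp only [Matrix.mul_apply, D, E, Matrix.of_apply, Finset.sum_add_distrib, add_mul]
  rw [h2] at h3
  have h4 : D i j = - ((g x)⁻¹ * E * (g x)⁻¹) i j := by linarith
  change D i j = _
  rw [h4, Matrix.mul_apply, Finset.sum_comm]
  congr 1
  refine Finset.sum_congr rfl fun b _ => ?_
  rw [Matrix.mul_apply, Finset.sum_mul]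
  refine Finset.sum_congr rfl fun a _ => ?_
  rw [inv_symm' hg hx b j]
  simp only [E, Matrix.of_apply]
  ring

lemma chr_inv {g : (Fin n → ℝ) → Matrix (Fin n) (Fin n) ℝ}
    (hg : IsRiemannianMetricOn g U) (hx : x ∈ U) (k i j : Fin n) :
    ∑ l, christoffel g i k l x * (g x)⁻¹ l j
      = ∑ a, ∑ b, (1 / 2) * ((g x)⁻¹ i a * (g x)⁻¹ j b *
        (pd k (fun y => g y b a) x + pd b (fun y => g y k a) x - pd a (fun y => g y k b) x)) := by
  unfold christoffel
  rw [Finset.sum_comm]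
  refine Finset.sum_congr rfl fun b _ => ?_
  rw [Finset.mul_sum, Finset.sum_mul]
  refine Finset.sum_congr rfl fun a _ => ?_
  rw [inv_symm' hg hx b j]
  ring

/-- Metric compatibility, for the inverse metric. -/
lemma compat (hU : IsOpen U) {g : (Fin n → ℝ) → Matrix (Fin n) (Fin n) ℝ}
    (hg : IsRiemannianMetricOn g U) (hx : x ∈ U) (k i j : Fin n) :
    pd k (fun y => (g y)⁻¹ i j) x
      = - ∑ l, (christoffel g i k l x * (g x)⁻¹ l j + christoffel g j k l x * (g x)⁻¹ l i) := by
  rw [Finset.sum_add_distrib, chr_inv hg hx, chr_inv hg hx k j i, pd_inv hU hg hx]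
  rw [Finset.sum_comm (f := fun a b => (1 / 2) * ((g x)⁻¹ j a * (g x)⁻¹ i b * _))]
  rw [← Finset.sum_add_distrib]
  congr 1
  refine Finset.sum_congr rfl fun a _ => ?_
  rw [← Finset.sum_add_distrib]
  refine Finset.sum_congr rfl fun b _ => ?_
  rw [pd_congr' hU (a := fun y => g y b a) (b := fun y => g y a b)
    (fun y hy => g_symm hg hy b a) hx]
  ring

/-- Antisymmetry of the curvature, with the last index raised. -/
lemma curv_anti (hU : IsOpen U) {g : (Fin n → ℝ) → Matrix (Fin n) (Fin n) ℝ}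
    (hg : IsRiemannianMetricOn g U) (hx : x ∈ U) (m i b l : Fin n) :
    ∑ k, (riemann g b m i k x * (g x)⁻¹ k l + riemann g l m i k x * (g x)⁻¹ k b) = 0 := by
  have hc := fun a b c => sm_diffAt hU (sm_chr hU hg a b c) hx
  have hH := fun a b => sm_diffAt hU (sm_inv hg a b) hx
  have key : ∀ m i, pd m (pd i (fun y => (g y)⁻¹ b l)) x
      = - ∑ s, (pd m (christoffel g b i s) x * (g x)⁻¹ s l
          + christoffel g b i s x * (- ∑ t, (christoffel g s m t x * (g x)⁻¹ t l
            + christoffel g l m t x * (g x)⁻¹ t s))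
          + (pd m (christoffel g l i s) x * (g x)⁻¹ s b
          + christoffel g l i s x * (- ∑ t, (christoffel g s m t x * (g x)⁻¹ t b
            + christoffel g b m t x * (g x)⁻¹ t s)))) := by
    intro m i
    rw [pd_congr' hU (fun y hy => compat hU hg hy i b l) hx, pd_neg',
      pd_sum' (fun s => ((hc _ _ _).fun_mul (hH _ _)).fun_add ((hc _ _ _).fun_mul (hH _ _)))]
    congr 1
    refine Finset.sum_congr rfl fun s _ => ?_
    rw [pd_add' ((hc _ _ _).fun_mul (hH _ _)) ((hc _ _ _).fun_mul (hH _ _)),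
      pd_mul' (hc _ _ _) (hH _ _), pd_mul' (hc _ _ _) (hH _ _), compat hU hg hx,
      compat hU hg hx]
  have h1 := pd_comm' hU (sm_inv hg b l) hx m i
  rw [key, key] at h1
  let P : Fin n → Matrix (Fin n) (Fin n) ℝ := fun i => Matrix.of fun p q => christoffel g p i q x
  let Q : Fin n → Fin n → Matrix (Fin n) (Fin n) ℝ :=
    fun m i => Matrix.of fun p q => pd m (christoffel g p i q) x
  have hHs : ((g x)⁻¹)ᵀ = (g x)⁻¹ := by
    ext p q
    exact inv_symm' hg hx q p
  have hR : ∀ p q, riemann g p m i q x = (Q m i - Q i m + P m * P i - P i * P m) p q := by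
    intro p q
    simp only [riemann, Matrix.sub_apply, Matrix.add_apply, Matrix.mul_apply, Q, P,
      Matrix.of_apply, Finset.sum_sub_distrib]
    ring
  have key2 : ∀ m i, ∑ s, (pd m (christoffel g b i s) x * (g x)⁻¹ s l
          + christoffel g b i s x * (- ∑ t, (christoffel g s m t x * (g x)⁻¹ t l
            + christoffel g l m t x * (g x)⁻¹ t s))
          + (pd m (christoffel g l i s) x * (g x)⁻¹ s b
          + christoffel g l i s x * (- ∑ t, (christoffel g s m t x * (g x)⁻¹ t b
            + christoffel g b m t x * (g x)⁻¹ t s))))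
      = (Q m i * (g x)⁻¹ - P i * (P m * (g x)⁻¹ + (P m * (g x)⁻¹)ᵀ)) b l
        + (Q m i * (g x)⁻¹ - P i * (P m * (g x)⁻¹ + (P m * (g x)⁻¹)ᵀ)) l b := by
    intro m i
    simp only [Matrix.sub_apply, Matrix.add_apply, Matrix.mul_apply, Q, P,
      Matrix.of_apply, Finset.sum_add_distrib, Matrix.transpose_apply, mul_neg,
      Finset.sum_neg_distrib]
    ring
  rw [key2, key2] at h1
  have h2 : ∑ k, (riemann g b m i k x * (g x)⁻¹ k l + riemann g l m i k x * (g x)⁻¹ k b)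
      = ((Q m i - Q i m + P m * P i - P i * P m) * (g x)⁻¹) b l
        + ((Q m i - Q i m + P m * P i - P i * P m) * (g x)⁻¹) l b := by
    rw [Finset.sum_add_distrib, Matrix.mul_apply, Matrix.mul_apply]
    simp only [hR]
  have h3 : (P i * (P m * (g x)⁻¹)ᵀ) l b = (P m * (P i * (g x)⁻¹)ᵀ) b l := by
    rw [← Matrix.transpose_apply (P i * (P m * (g x)⁻¹)ᵀ)]
    simp only [Matrix.transpose_mul, Matrix.transpose_transpose, hHs, Matrix.mul_assoc]
  have h4 : (P i * (P m * (g x)⁻¹)ᵀ) b l = (P m * (P i * (g x)⁻¹)ᵀ) l b := by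
    rw [← Matrix.transpose_apply (P i * (P m * (g x)⁻¹)ᵀ)]
    simp only [Matrix.transpose_mul, Matrix.transpose_transpose, hHs, Matrix.mul_assoc]
  rw [h2]
  simp only [Matrix.add_mul, Matrix.sub_mul, Matrix.mul_add, Matrix.add_apply,
    Matrix.sub_apply, Matrix.mul_assoc] at h1 h3 h4 ⊢
  linarith

/-- The covariant derivative of the Hessian. -/
noncomputable def covHess (g : (Fin n → ℝ) → Matrix (Fin n) (Fin n) ℝ) (f : (Fin n → ℝ) → ℝ)
    (m k i : Fin n) (x : Fin n → ℝ) : ℝ :=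
  pd m (hessC g f k i) x - ∑ l, christoffel g l m k x * hessC g f l i x
    - ∑ l, christoffel g l m i x * hessC g f k l x

lemma covHess_symm (hU : IsOpen U) {g : (Fin n → ℝ) → Matrix (Fin n) (Fin n) ℝ}
    (hg : IsRiemannianMetricOn g U) {f : (Fin n → ℝ) → ℝ}
    (hf : ContDiffOn ℝ (⊤ : ℕ∞) f U) (hx : x ∈ U) (m k i : Fin n) :
    covHess g f m k i x = covHess g f m i k x := by
  unfold covHess
  rw [pd_congr' hU (fun y hy => hess_symm hU hg hf hy k i) hx]
  simp only [hess_symm hU hg hf hx k, hess_symm hU hg hf hx i]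
  simp only [hess_symm hU hg hf hx _ k, hess_symm hU hg hf hx _ i]
  ring

/-- The Ricci identity. -/
lemma ricci_identity (hU : IsOpen U) {g : (Fin n → ℝ) → Matrix (Fin n) (Fin n) ℝ}
    (hg : IsRiemannianMetricOn g U) {f : (Fin n → ℝ) → ℝ}
    (hf : ContDiffOn ℝ (⊤ : ℕ∞) f U) (hx : x ∈ U) (m i k : Fin n) :
    covHess g f m i k x = covHess g f i m k x - ∑ l, riemann g l m i k x * pd l f x := by
  have hc := fun a b c => sm_diffAt hU (sm_chr hU hg a b c) hx
  have hu := fun a => sm_diffAt hU (sm_pd hU hf a) hx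
  have huu := fun a b => sm_diffAt hU (sm_pd hU (sm_pd hU hf a) b) hx
  have key : ∀ m i, pd m (hessC g f i k) x = pd m (pd i (pd k f)) x
      - ∑ l, (pd m (christoffel g l i k) x * pd l f x
        + christoffel g l i k x * pd m (pd l f) x) := by
    intro m i
    have h0 : hessC g f i k = fun y => pd i (pd k f) y
      - ∑ l, christoffel g l i k y * pd l f y := rfl
    rw [h0, pd_sub' (huu _ _) (DifferentiableAt.fun_sum fun l _ => (hc _ _ _).fun_mul (hu _)),
      pd_sum' (fun l => (hc _ _ _).fun_mul (hu _))]
    congr 1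
    exact Finset.sum_congr rfl fun l _ => pd_mul' (hc _ _ _) (hu _) m
  have hsw : ∀ m i, ∑ l, christoffel g l m k x * ∑ s, christoffel g s i l x * pd s f x
      = ∑ l, (∑ s, christoffel g l i s x * christoffel g s m k x) * pd l f x := by
    intro m i
    simp only [Finset.mul_sum, Finset.sum_mul]
    rw [Finset.sum_comm]
    exact Finset.sum_congr rfl fun l _ => Finset.sum_congr rfl fun s _ => by ring
  have h1 := hsw m i
  have h2 := hsw i m
  unfold covHess
  rw [key, key, pd_comm' hU (sm_pd hU hf k) hx m i]
  simp only [chr_symm hU hg hx _ i m]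
  have e : ∀ m i, ∑ l, christoffel g l m k x * hessC g f i l x
      = ∑ l, christoffel g l m k x * pd i (pd l f) x
        - ∑ l, christoffel g l m k x * ∑ s, christoffel g s i l x * pd s f x := by
    intro m i
    rw [← Finset.sum_sub_distrib]
    exact Finset.sum_congr rfl fun l _ => by unfold hessC; ring
  rw [e, e, h1, h2]
  simp only [riemann, add_mul, sub_mul, Finset.sum_add_distrib, Finset.sum_sub_distrib]
  ring

lemma pd_grad (hU : IsOpen U) {g : (Fin n → ℝ) → Matrix (Fin n) (Fin n) ℝ}
    (hg : IsRiemannianMetricOn g U) {f : (Fin n → ℝ) → ℝ}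
    (hf : ContDiffOn ℝ (⊤ : ℕ∞) f U) (hx : x ∈ U) (k i : Fin n) :
    pd k (fun y => grad g f y i) x = ∑ j, (g x)⁻¹ i j * hessC g f k j x
      - ∑ l, christoffel g i k l x * grad g f x l := by
  have hu := fun a => sm_diffAt hU (sm_pd hU hf a) hx
  have hH := fun a b => sm_diffAt hU (sm_inv hg a b) hx
  unfold grad
  rw [pd_sum' (fun l => (hH _ _).fun_mul (hu _))]
  simp only [pd_mul' (hH _ _) (hu _), compat hU hg hx, hessC]
  simp only [mul_sub, Finset.mul_sum, Finset.sum_sub_distrib, Finset.sum_add_distrib, neg_mul,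
    add_mul, Finset.sum_mul, Finset.sum_neg_distrib]
  have e1 : ∑ j, ∑ l, christoffel g i k l x * (g x)⁻¹ l j * pd j f x
      = ∑ l, ∑ j, christoffel g i k l x * ((g x)⁻¹ l j * pd j f x) := by
    rw [Finset.sum_comm]
    exact Finset.sum_congr rfl fun l _ => Finset.sum_congr rfl fun s _ => by ring
  have e2 : ∑ j, ∑ l, christoffel g j k l x * (g x)⁻¹ l i * pd j f x
      = ∑ l, ∑ j, (g x)⁻¹ i l * (christoffel g j k l x * pd j f x) := by
    rw [Finset.sum_comm]
    refine Finset.sum_congr rfl fun l _ => Finset.sum_congr rfl fun s _ => ?_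
    rw [inv_symm' hg hx l i]
    ring
  rw [e1, e2]
  ring

lemma gip_grad {g : (Fin n → ℝ) → Matrix (Fin n) (Fin n) ℝ}
    (hg : IsRiemannianMetricOn g U) (f : (Fin n → ℝ) → ℝ) (v : Fin n → ℝ)
    (hx : x ∈ U) : gip g x v (grad g f x) = ∑ i, v i * pd i f x := by
  have h : (g x).mulVec ((g x)⁻¹.mulVec (fun j => pd j f x)) = fun j => pd j f x := by
    rw [Matrix.mulVec_mulVec, Matrix.mul_nonsing_inv _ (g_unit hg hx), Matrix.one_mulVec]
  unfold gip
  refine Finset.sum_congr rfl fun i _ => ?_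
  have hi := congrFun h i
  have e : (g x).mulVec ((g x)⁻¹.mulVec (fun j => pd j f x)) i
    = ∑ j, g x i j * grad g f x j := rfl
  rw [e] at hi
  rw [← hi, Finset.mul_sum]
  exact Finset.sum_congr rfl fun j _ => by ring

lemma pd_gradNormSq (hU : IsOpen U) {g : (Fin n → ℝ) → Matrix (Fin n) (Fin n) ℝ}
    (hg : IsRiemannianMetricOn g U) {f : (Fin n → ℝ) → ℝ}
    (hf : ContDiffOn ℝ (⊤ : ℕ∞) f U) (hx : x ∈ U) (k : Fin n) :
    pd k (gradNormSq g f) x = ∑ i, 2 * (hessC g f k i x * grad g f x i) := by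
  have hu := fun a => sm_diffAt hU (sm_pd hU hf a) hx
  have hV := fun a => sm_diffAt hU (sm_grad hU hg hf a) hx
  rw [pd_congr' hU (a := gradNormSq g f) (b := fun y => ∑ i, grad g f y i * pd i f y)
    (fun y hy => gip_grad hg f _ hy) hx, pd_sum' (fun l => (hV _).fun_mul (hu _))]
  simp only [pd_mul' (hV _) (hu _), pd_grad hU hg hf hx]
  have e1 : ∑ i, (∑ j, (g x)⁻¹ i j * hessC g f k j x) * pd i f x
      = ∑ i, hessC g f k i x * grad g f x i := by
    simp only [grad, Finset.sum_mul, Finset.mul_sum]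
    rw [Finset.sum_comm]
    refine Finset.sum_congr rfl fun l _ => Finset.sum_congr rfl fun s _ => ?_
    rw [inv_symm' hg hx s l]
    ring
  have e2 : ∑ i, (∑ l, christoffel g i k l x * grad g f x l) * pd i f x
      = ∑ i, grad g f x i * ∑ l, christoffel g l k i x * pd l f x := by
    simp only [Finset.sum_mul, Finset.mul_sum]
    rw [Finset.sum_comm]
    exact Finset.sum_congr rfl fun l _ => Finset.sum_congr rfl fun s _ => by ring
  have e3 : ∑ i, grad g f x i * pd k (pd i f) x
      = ∑ i, hessC g f k i x * grad g f x i
        + ∑ i, grad g f x i * ∑ l, christoffel g l k i x * pd l f x := by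
    rw [← Finset.sum_add_distrib]
    exact Finset.sum_congr rfl fun l _ => by unfold hessC; ring
  rw [Finset.sum_add_distrib, e3]
  simp only [sub_mul, Finset.sum_sub_distrib]
  rw [e1, e2, ← Finset.mul_sum]
  ring

lemma hess_gradNormSq (hU : IsOpen U) {g : (Fin n → ℝ) → Matrix (Fin n) (Fin n) ℝ}
    (hg : IsRiemannianMetricOn g U) {f : (Fin n → ℝ) → ℝ}
    (hf : ContDiffOn ℝ (⊤ : ℕ∞) f U) (hx : x ∈ U) (m k : Fin n) :
    hessC g (gradNormSq g f) m k x
      = 2 * ∑ i, covHess g f m k i x * grad g f x i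
        + 2 * ∑ i, ∑ j, (g x)⁻¹ i j * hessC g f k i x * hessC g f m j x := by
  have hh := fun a b => sm_diffAt hU (sm_hess hU hg hf a b) hx
  have hV := fun a => sm_diffAt hU (sm_grad hU hg hf a) hx
  rw [hessC, pd_congr' hU (fun y hy => pd_gradNormSq hU hg hf hy k) hx]
  simp only [← Finset.mul_sum, pd_gradNormSq hU hg hf hx]
  rw [pd_mul' (differentiableAt_const _)
    (DifferentiableAt.fun_sum fun l _ => (hh _ _).fun_mul (hV _)), pd_const',
    pd_sum' (fun l => (hh _ _).fun_mul (hV _))]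
  simp only [pd_mul' (hh _ _) (hV _), pd_grad hU hg hf hx, covHess]
  simp only [sub_mul, mul_sub, Finset.sum_sub_distrib, Finset.sum_add_distrib]
  have e1 : ∑ i, hessC g f k i x * ∑ j, (g x)⁻¹ i j * hessC g f m j x
      = ∑ i, ∑ j, (g x)⁻¹ i j * hessC g f k i x * hessC g f m j x := by
    simp only [Finset.mul_sum]
    exact Finset.sum_congr rfl fun l _ => Finset.sum_congr rfl fun s _ => by ring
  have e2 : ∑ i, hessC g f k i x * ∑ l, christoffel g i m l x * grad g f x l
      = ∑ i, (∑ l, christoffel g l m i x * hessC g f k l x) * grad g f x i := by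
    simp only [Finset.mul_sum, Finset.sum_mul]
    rw [Finset.sum_comm]
    exact Finset.sum_congr rfl fun l _ => Finset.sum_congr rfl fun s _ => by ring
  have e3 : ∑ l, christoffel g l m k x * (2 * ∑ i, hessC g f l i x * grad g f x i)
      = 2 * ∑ i, (∑ l, christoffel g l m k x * hessC g f l i x) * grad g f x i := by
    simp only [Finset.mul_sum, Finset.sum_mul]
    rw [Finset.sum_comm]
    exact Finset.sum_congr rfl fun l _ => Finset.sum_congr rfl fun s _ => by ring
  rw [e1, e2, e3]
  ring

lemma pd_lap (hU : IsOpen U) {g : (Fin n → ℝ) → Matrix (Fin n) (Fin n) ℝ}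
    (hg : IsRiemannianMetricOn g U) {f : (Fin n → ℝ) → ℝ}
    (hf : ContDiffOn ℝ (⊤ : ℕ∞) f U) (hx : x ∈ U) (i : Fin n) :
    pd i (lap g f) x = ∑ m, ∑ k, (g x)⁻¹ m k * covHess g f i m k x := by
  have hh := fun a b => sm_diffAt hU (sm_hess hU hg hf a b) hx
  have hH := fun a b => sm_diffAt hU (sm_inv hg a b) hx
  have h0 : lap g f = fun y => ∑ m, ∑ k, (g y)⁻¹ m k * hessC g f m k y := rfl
  rw [h0, pd_sum' (fun m => DifferentiableAt.fun_sum fun l _ => (hH _ _).fun_mul (hh _ _))]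
  simp only [pd_sum' (fun l => (hH _ _).fun_mul (hh _ _)), pd_mul' (hH _ _) (hh _ _),
    compat hU hg hx, covHess]
  simp only [sub_mul, mul_sub, Finset.sum_sub_distrib, Finset.sum_add_distrib, neg_mul,
    add_mul, Finset.sum_neg_distrib]
  have e1 : ∑ m, ∑ k, (∑ l, christoffel g m i l x * (g x)⁻¹ l k) * hessC g f m k x
      = ∑ m, ∑ k, (g x)⁻¹ m k * ∑ l, christoffel g l i m x * hessC g f l k x := by
    simp only [Finset.mul_sum, Finset.sum_mul]
    rw [Finset.sum_comm]
    conv_rhs => rw [Finset.sum_comm]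
    refine Finset.sum_congr rfl fun k _ => ?_
    rw [Finset.sum_comm]
    exact Finset.sum_congr rfl fun l _ => Finset.sum_congr rfl fun s _ => by ring
  have e2 : ∑ m, ∑ k, (∑ l, christoffel g k i l x * (g x)⁻¹ l m) * hessC g f m k x
      = ∑ m, ∑ k, (g x)⁻¹ m k * ∑ l, christoffel g l i k x * hessC g f m l x := by
    simp only [Finset.mul_sum, Finset.sum_mul]
    refine Finset.sum_congr rfl fun m _ => ?_
    rw [Finset.sum_comm]
    refine Finset.sum_congr rfl fun l _ => Finset.sum_congr rfl fun s _ => ?_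
    rw [inv_symm' hg hx l m]
    ring
  simp only [Finset.sum_add_distrib, add_mul, neg_add_rev, Finset.sum_neg_distrib, e1, e2]
  ring

end BochnerHelpers

/-- **The Bochner formula.**  On a Riemannian manifold `(M, g)` (presented in a coordinate
chart `U`), for any smooth function `f`, at every point one has
`(1/2) Δ|∇f|² = Rc(∇f, ∇f) + |∇²f|² + ⟨∇f, ∇(Δf)⟩`. -/
theorem bochner_formula {n : ℕ} (g : (Fin n → ℝ) → Matrix (Fin n) (Fin n) ℝ)
    (U : Set (Fin n → ℝ)) (hU : IsOpen U) (hg : IsRiemannianMetricOn g U)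
    (f : (Fin n → ℝ) → ℝ) (hf : ContDiffOn ℝ (⊤ : ℕ∞) f U) :
    ∀ x ∈ U,
      (1 / 2) * lap g (gradNormSq g f) x
        = ricci g x (grad g f x) (grad g f x) + hessNormSq g f x
            + gip g x (grad g f x) (grad g (lap g f) x) := by
  intro x hx
  rw [gip_grad hg _ _ hx]
  simp only [pd_lap hU hg hf hx]
  have hl : (1 / 2) * lap g (gradNormSq g f) x
      = ∑ m, ∑ k, (g x)⁻¹ m k * ∑ i, covHess g f m k i x * grad g f x i
        + ∑ m, ∑ k, (g x)⁻¹ m k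
          * ∑ i, ∑ j, (g x)⁻¹ i j * hessC g f k i x * hessC g f m j x := by
    unfold lap
    rw [Finset.mul_sum, ← Finset.sum_add_distrib]
    refine Finset.sum_congr rfl fun m _ => ?_
    rw [Finset.mul_sum, ← Finset.sum_add_distrib]
    refine Finset.sum_congr rfl fun k _ => ?_
    rw [hess_gradNormSq hU hg hf hx]
    ring
  have hn : ∑ m, ∑ k, (g x)⁻¹ m k
          * ∑ i, ∑ j, (g x)⁻¹ i j * hessC g f k i x * hessC g f m j x
      = hessNormSq g f x := by
    unfold hessNormSq
    refine Finset.sum_congr rfl fun m _ => ?_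
    simp only [Finset.mul_sum]
    -- left: k, i, j ; right: j, k, i
    have a1 : ∀ k, ∑ i, ∑ j, (g x)⁻¹ m k * ((g x)⁻¹ i j * hessC g f k i x * hessC g f m j x)
        = ∑ j, ∑ i, (g x)⁻¹ m k * ((g x)⁻¹ i j * hessC g f k i x * hessC g f m j x) :=
      fun k => Finset.sum_comm
    simp only [a1]
    rw [Finset.sum_comm]
    refine Finset.sum_congr rfl fun j _ => Finset.sum_congr rfl fun k _ =>
      Finset.sum_congr rfl fun i _ => ?_
    rw [inv_symm' hg hx i j]
    ring
  have hT : ∑ m, ∑ k, (g x)⁻¹ m k * ∑ i, covHess g f m k i x * grad g f x i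
      = ∑ i, grad g f x i * ∑ m, ∑ k, (g x)⁻¹ m k * covHess g f i m k x
        - ∑ i, grad g f x i * ∑ m, ∑ k, (g x)⁻¹ m k * ∑ l, riemann g l m i k x * pd l f x := by
    rw [← Finset.sum_sub_distrib]
    simp only [← mul_sub, ← Finset.sum_sub_distrib]
    simp only [← ricci_identity hU hg hf hx]
    simp only [Finset.mul_sum]
    conv_rhs => rw [Finset.sum_comm]
    refine Finset.sum_congr rfl fun m _ => ?_
    conv_rhs => rw [Finset.sum_comm]
    refine Finset.sum_congr rfl fun k _ => Finset.sum_congr rfl fun i _ => ?_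
    rw [covHess_symm hU hg hf hx m k i]
    ring
  have hR : ∀ i m, ∑ k, (g x)⁻¹ m k * ∑ l, riemann g l m i k x * pd l f x
      = - ∑ k, riemann g m m i k x * grad g f x k := by
    intro i m
    have b1 : ∑ l, (∑ k, (riemann g m m i k x * (g x)⁻¹ k l
        + riemann g l m i k x * (g x)⁻¹ k m)) * pd l f x = 0 := by
      simp [curv_anti hU hg hx]
    rw [← add_eq_zero_iff_eq_neg, ← b1]
    simp only [grad, Finset.mul_sum, Finset.sum_mul, Finset.sum_add_distrib, add_mul]
    rw [add_comm]
    congr 1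
    · rw [Finset.sum_comm]
      exact Finset.sum_congr rfl fun l _ => Finset.sum_congr rfl fun s _ => by ring
    · rw [Finset.sum_comm]
      refine Finset.sum_congr rfl fun l _ => Finset.sum_congr rfl fun s _ => ?_
      rw [inv_symm' hg hx m s]
      ring
  have hRic : ricci g x (grad g f x) (grad g f x)
      = - ∑ i, grad g f x i * ∑ m, ∑ k, (g x)⁻¹ m k * ∑ l, riemann g l m i k x * pd l f x := by
    simp only [hR, Finset.sum_neg_distrib, mul_neg, neg_neg]
    unfold ricci
    refine Finset.sum_congr rfl fun i _ => ?_
    simp only [Finset.mul_sum, Finset.sum_mul]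
    rw [Finset.sum_comm]
    exact Finset.sum_congr rfl fun l _ => Finset.sum_congr rfl fun s _ => by ring
  rw [hl, hn, hT, hRic]
  ring
end

section
/- Let f be a smooth function on a Riemannian manifold M with |∇f| ≠ 0 on an open set U, let X = ∇f/|∇f|², and let {e₁,...,e_n} be an orthonormal frame at p ∈ U. Then at p: div(∇_X ∇f) = −2 Σ_{i=1}^n ∇²f(e_i, X)² + (|X|²/2) Δ|∇f|². -/
/-!
We formalize Riemannian geometry on a coordinate chart: a Riemannian metric on an open
subset of `ℝⁿ` is given by a smooth field of positive definite symmetric matrices `g`.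
All of the classical objects (Levi-Civita connection via Christoffel symbols, curvature,
Ricci curvature, gradient, Hessian, Laplace–Beltrami operator, divergence, covariant
derivatives of vector fields) are defined below by their standard coordinate formulas.
-/

open scoped BigOperators
open Matrix MeasureTheory

section helpers
open Finset

variable {n : ℕ}

theorem aux_pd_smooth {U : Set (Fin n → ℝ)} (hU : IsOpen U) {h : (Fin n → ℝ) → ℝ}
    (hh : ContDiffOn ℝ (⊤ : ℕ∞) h U) (i : Fin n) : ContDiffOn ℝ (⊤ : ℕ∞) (pd i h) U := by
  have h1 : ContDiffOn ℝ (⊤ : ℕ∞) (fderiv ℝ h) U :=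
    hh.fderiv_of_isOpen hU (by exact_mod_cast le_top)
  exact h1.clm_apply contDiffOn_const

theorem aux_diff {U : Set (Fin n → ℝ)} (hU : IsOpen U) {h : (Fin n → ℝ) → ℝ}
    (hh : ContDiffOn ℝ (⊤ : ℕ∞) h U) {x : Fin n → ℝ} (hx : x ∈ U) :
    DifferentiableAt ℝ h x :=
  (hh.contDiffAt (hU.mem_nhds hx)).differentiableAt (by simp)

theorem aux_det_smooth {U : Set (Fin n → ℝ)} {A : (Fin n → ℝ) → Matrix (Fin n) (Fin n) ℝ}
    (hA : ∀ i j, ContDiffOn ℝ (⊤ : ℕ∞) (fun x => A x i j) U) :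
    ContDiffOn ℝ (⊤ : ℕ∞) (fun x => (A x).det) U := by
  simp only [Matrix.det_apply']
  refine ContDiffOn.sum fun σ _ => ?_
  exact contDiffOn_const.mul (contDiffOn_prod fun i _ => hA _ _)

theorem aux_inv_smooth {g : (Fin n → ℝ) → Matrix (Fin n) (Fin n) ℝ} {U : Set (Fin n → ℝ)}
    (hg : IsRiemannianMetricOn g U) (i j : Fin n) :
    ContDiffOn ℝ (⊤ : ℕ∞) (fun x => (g x)⁻¹ i j) U := by
  have h : (fun x => (g x)⁻¹ i j) = fun x => ((g x).det)⁻¹ * ((g x).updateRow j (Pi.single i 1)).det := by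
    funext x
    rw [Matrix.inv_def, Matrix.smul_apply, Matrix.adjugate_apply, Ring.inverse_eq_inv', smul_eq_mul]
  rw [h]
  refine ((aux_det_smooth hg.1).inv fun x hx => (hg.2 x hx).det_pos.ne').mul (aux_det_smooth ?_)
  intro a b
  by_cases hab : a = j
  · simp only [Matrix.updateRow_apply, if_pos hab]; exact contDiffOn_const
  · simp only [Matrix.updateRow_apply, if_neg hab]; exact hg.1 a b

theorem aux_grad_smooth {g : (Fin n → ℝ) → Matrix (Fin n) (Fin n) ℝ} {U : Set (Fin n → ℝ)}
    (hU : IsOpen U) (hg : IsRiemannianMetricOn g U) {h : (Fin n → ℝ) → ℝ}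
    (hh : ContDiffOn ℝ (⊤ : ℕ∞) h U) (k : Fin n) :
    ContDiffOn ℝ (⊤ : ℕ∞) (fun x => grad g h x k) U := by
  unfold grad
  exact ContDiffOn.sum fun j _ => (aux_inv_smooth hg k j).mul (aux_pd_smooth hU hh j)

theorem aux_norm_smooth {g : (Fin n → ℝ) → Matrix (Fin n) (Fin n) ℝ} {U : Set (Fin n → ℝ)}
    (hU : IsOpen U) (hg : IsRiemannianMetricOn g U) {h : (Fin n → ℝ) → ℝ}
    (hh : ContDiffOn ℝ (⊤ : ℕ∞) h U) :
    ContDiffOn ℝ (⊤ : ℕ∞) (gradNormSq g h) U := by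
  unfold gradNormSq gip
  exact ContDiffOn.sum fun i _ => ContDiffOn.sum fun j _ =>
    ((hg.1 i j).mul (aux_grad_smooth hU hg hh i)).mul (aux_grad_smooth hU hg hh j)

theorem aux_pd_mul {a b : (Fin n → ℝ) → ℝ} {x : Fin n → ℝ} (i : Fin n)
    (ha : DifferentiableAt ℝ a x) (hb : DifferentiableAt ℝ b x) :
    pd i (fun y => a y * b y) x = pd i a x * b x + a x * pd i b x := by
  unfold pd
  rw [fderiv_fun_mul ha hb]
  simp; ring

theorem aux_pd_sum {a : Fin n → (Fin n → ℝ) → ℝ} {x : Fin n → ℝ} (i : Fin n)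
    (ha : ∀ k, DifferentiableAt ℝ (a k) x) :
    pd i (fun y => ∑ k, a k y) x = ∑ k, pd i (a k) x := by
  unfold pd
  rw [fderiv_fun_sum fun k _ => ha k]
  simp

theorem aux_pd_congr {U : Set (Fin n → ℝ)} (hU : IsOpen U) {a b : (Fin n → ℝ) → ℝ}
    (hab : ∀ y ∈ U, a y = b y) {x : Fin n → ℝ} (hx : x ∈ U) (i : Fin n) :
    pd i a x = pd i b x := by
  unfold pd
  rw [Filter.EventuallyEq.fderiv_eq (Filter.eventuallyEq_of_mem (hU.mem_nhds hx) hab)]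

theorem aux_symm {g : (Fin n → ℝ) → Matrix (Fin n) (Fin n) ℝ} {U : Set (Fin n → ℝ)}
    (hg : IsRiemannianMetricOn g U) {x : Fin n → ℝ} (hx : x ∈ U) (i j : Fin n) :
    g x i j = g x j i := by
  have := (hg.2 x hx).isHermitian.apply j i
  simpa using this

theorem aux_inv_symm {g : (Fin n → ℝ) → Matrix (Fin n) (Fin n) ℝ} {U : Set (Fin n → ℝ)}
    (hg : IsRiemannianMetricOn g U) {x : Fin n → ℝ} (hx : x ∈ U) (i j : Fin n) :
    (g x)⁻¹ i j = (g x)⁻¹ j i := by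
  have := (hg.2 x hx).isHermitian.inv.apply j i
  simpa using this

theorem aux_pd_symm {g : (Fin n → ℝ) → Matrix (Fin n) (Fin n) ℝ} {U : Set (Fin n → ℝ)}
    (hU : IsOpen U) (hg : IsRiemannianMetricOn g U) {x : Fin n → ℝ} (hx : x ∈ U)
    (m i j : Fin n) :
    pd m (fun y => g y i j) x = pd m (fun y => g y j i) x :=
  aux_pd_congr hU (fun y hy => aux_symm hg hy i j) hx m

theorem aux_lower_raise {g : (Fin n → ℝ) → Matrix (Fin n) (Fin n) ℝ} {U : Set (Fin n → ℝ)}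
    (hg : IsRiemannianMetricOn g U) {x : Fin n → ℝ} (hx : x ∈ U) (w : Fin n → ℝ) (m : Fin n) :
    ∑ k, g x m k * ∑ l, (g x)⁻¹ k l * w l = w m := by
  have h : g x *ᵥ ((g x)⁻¹ *ᵥ w) = w := by
    rw [Matrix.mulVec_mulVec, Matrix.mul_nonsing_inv _ (hg.2 x hx).det_pos.ne'.isUnit,
      Matrix.one_mulVec]
  exact congrFun h m

theorem aux_raise_lower {g : (Fin n → ℝ) → Matrix (Fin n) (Fin n) ℝ} {U : Set (Fin n → ℝ)}
    (hg : IsRiemannianMetricOn g U) {x : Fin n → ℝ} (hx : x ∈ U) (v : Fin n → ℝ) (m : Fin n) :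
    ∑ k, (g x)⁻¹ m k * ∑ l, g x k l * v l = v m := by
  have h : (g x)⁻¹ *ᵥ (g x *ᵥ v) = v := by
    rw [Matrix.mulVec_mulVec, Matrix.nonsing_inv_mul _ (hg.2 x hx).det_pos.ne'.isUnit,
      Matrix.one_mulVec]
  exact congrFun h m

theorem aux_chr_lower {g : (Fin n → ℝ) → Matrix (Fin n) (Fin n) ℝ} {U : Set (Fin n → ℝ)}
    (hg : IsRiemannianMetricOn g U) {x : Fin n → ℝ} (hx : x ∈ U) (m i j : Fin n) :
    ∑ k, g x m k * christoffel g k i j x =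
      (1 / 2) * (pd i (fun y => g y j m) x + pd j (fun y => g y i m) x
        - pd m (fun y => g y i j) x) := by
  rw [← aux_lower_raise hg hx (fun l => (pd i (fun y => g y j l) x + pd j (fun y => g y i l) x
        - pd l (fun y => g y i j) x)) m, mul_sum]
  refine sum_congr rfl fun k _ => ?_
  unfold christoffel
  ring

/-- contraction of the Christoffel symbols with the differential -/
theorem aux_chr_df {g : (Fin n → ℝ) → Matrix (Fin n) (Fin n) ℝ} {U : Set (Fin n → ℝ)}
    (hg : IsRiemannianMetricOn g U) {x : Fin n → ℝ} (hx : x ∈ U) (h : (Fin n → ℝ) → ℝ)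
    (i j : Fin n) :
    ∑ k, christoffel g k i j x * pd k h x =
      ∑ m, (1 / 2) * (pd i (fun y => g y j m) x + pd j (fun y => g y i m) x
        - pd m (fun y => g y i j) x) * grad g h x m := by
  simp only [← aux_chr_lower hg hx, sum_mul]
  rw [sum_comm]
  refine sum_congr rfl fun k _ => ?_
  rw [← aux_lower_raise hg hx (fun l => pd l h x) k, mul_sum]
  refine sum_congr rfl fun m _ => ?_
  rw [aux_symm hg hx k m]
  unfold grad
  ring

theorem aux_hess_symm {g : (Fin n → ℝ) → Matrix (Fin n) (Fin n) ℝ} {U : Set (Fin n → ℝ)}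
    (hU : IsOpen U) (hg : IsRiemannianMetricOn g U) {h : (Fin n → ℝ) → ℝ}
    (hh : ContDiffOn ℝ (⊤ : ℕ∞) h U) {x : Fin n → ℝ} (hx : x ∈ U) (i j : Fin n) :
    hessC g h i j x = hessC g h j i x := by
  unfold hessC
  have hc : ∀ k, christoffel g k i j x = christoffel g k j i x := by
    intro k
    unfold christoffel
    congr 1
    refine sum_congr rfl fun l _ => ?_
    rw [aux_pd_symm hU hg hx l i j]
    ring
  simp only [hc]
  congr 1
  have hC := hh.contDiffAt (hU.mem_nhds hx)
  have hs : IsSymmSndFDerivAt ℝ h x := hC.isSymmSndFDerivAt (by rw [minSmoothness_of_isRCLikeNormedField]; exact WithTop.coe_le_coe.2 (le_top (a := (2 : ℕ∞))))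
  have hd : DifferentiableAt ℝ (fderiv ℝ h) x :=
    (hC.fderiv_right (m := (⊤ : ℕ∞)) (by exact_mod_cast le_top)).differentiableAt (by simp)
  have key : ∀ a b : Fin n, pd a (pd b h) x =
      fderiv ℝ (fderiv ℝ h) x (Pi.single a 1) (Pi.single b 1) := by
    intro a b
    unfold pd
    rw [fderiv_clm_apply hd (by fun_prop)]
    simp
  rw [key, key]
  exact hs.eq _ _

theorem aux_pd_lower_grad {g : (Fin n → ℝ) → Matrix (Fin n) (Fin n) ℝ} {U : Set (Fin n → ℝ)}
    (hU : IsOpen U) (hg : IsRiemannianMetricOn g U) {h : (Fin n → ℝ) → ℝ}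
    (hh : ContDiffOn ℝ (⊤ : ℕ∞) h U) {x : Fin n → ℝ} (hx : x ∈ U) (i m : Fin n) :
    pd i (pd m h) x = ∑ k, (pd i (fun y => g y m k) x * grad g h x k
      + g x m k * pd i (fun y => grad g h y k) x) := by
  have h1 : ∀ y ∈ U, pd m h y = ∑ k, g y m k * grad g h y k := fun y hy =>
    (aux_lower_raise hg hy (fun l => pd l h y) m).symm
  have hd1 := fun k => aux_diff hU (hg.1 m k) hx
  have hd2 := fun k => aux_diff hU (aux_grad_smooth hU hg hh k) hx
  rw [aux_pd_congr hU h1 hx, aux_pd_sum i fun k => (hd1 k).fun_mul (hd2 k)]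
  exact sum_congr rfl fun k _ => aux_pd_mul i (hd1 k) (hd2 k)

/-- `∇_i (∇h)^k = g^{kl} ∇²_{il} h` -/
theorem aux_pd_grad {g : (Fin n → ℝ) → Matrix (Fin n) (Fin n) ℝ} {U : Set (Fin n → ℝ)}
    (hU : IsOpen U) (hg : IsRiemannianMetricOn g U) {h : (Fin n → ℝ) → ℝ}
    (hh : ContDiffOn ℝ (⊤ : ℕ∞) h U) {x : Fin n → ℝ} (hx : x ∈ U) (i k : Fin n) :
    pd i (fun y => grad g h y k) x + ∑ j, christoffel g k i j x * grad g h x j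
      = ∑ l, (g x)⁻¹ k l * hessC g h i l x := by
  rw [← aux_raise_lower hg hx (fun k => pd i (fun y => grad g h y k) x
    + ∑ j, christoffel g k i j x * grad g h x j) k]
  refine sum_congr rfl fun m _ => ?_
  congr 1
  have h2 : ∑ l, g x m l * ∑ j, christoffel g l i j x * grad g h x j =
      ∑ j, (1 / 2) * (pd i (fun y => g y j m) x + pd j (fun y => g y i m) x
        - pd m (fun y => g y i j) x) * grad g h x j := by
    simp only [← aux_chr_lower hg hx, sum_mul, mul_sum]
    rw [sum_comm]
    exact sum_congr rfl fun _ _ => sum_congr rfl fun _ _ => by ring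
  unfold hessC
  rw [aux_chr_df hg hx, aux_pd_lower_grad hU hg hh hx]
  simp only [mul_add]
  rw [sum_add_distrib, h2, sum_add_distrib, add_sub_right_comm, add_comm, ← sum_sub_distrib]
  congr 1
  refine sum_congr rfl fun j _ => ?_
  rw [aux_pd_symm hU hg hx i j m]
  ring

theorem aux_cov_grad {g : (Fin n → ℝ) → Matrix (Fin n) (Fin n) ℝ} {U : Set (Fin n → ℝ)}
    (hU : IsOpen U) (hg : IsRiemannianMetricOn g U) {h : (Fin n → ℝ) → ℝ}
    (hh : ContDiffOn ℝ (⊤ : ℕ∞) h U) {x : Fin n → ℝ} (hx : x ∈ U) (v : Fin n → ℝ) (k : Fin n) :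
    covDeriv g (grad g h) v x k = ∑ i, v i * ∑ l, (g x)⁻¹ k l * hessC g h i l x := by
  simp only [← aux_pd_grad hU hg hh hx, covDeriv, mul_add, sum_add_distrib, mul_sum]
  congr 1
  exact sum_congr rfl fun _ _ => sum_congr rfl fun _ _ => by ring

theorem aux_div_grad {g : (Fin n → ℝ) → Matrix (Fin n) (Fin n) ℝ} {U : Set (Fin n → ℝ)}
    (hU : IsOpen U) (hg : IsRiemannianMetricOn g U) {h : (Fin n → ℝ) → ℝ}
    (hh : ContDiffOn ℝ (⊤ : ℕ∞) h U) {x : Fin n → ℝ} (hx : x ∈ U) :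
    divVF g (grad g h) x = lap g h x := by
  unfold divVF lap
  refine sum_congr rfl fun k _ => ?_
  rw [aux_cov_grad hU hg hh hx]
  simp [Pi.single_apply]

theorem aux_norm_eq {g : (Fin n → ℝ) → Matrix (Fin n) (Fin n) ℝ} {U : Set (Fin n → ℝ)}
    (hg : IsRiemannianMetricOn g U) (h : (Fin n → ℝ) → ℝ)
    {x : Fin n → ℝ} (hx : x ∈ U) :
    gradNormSq g h x = ∑ k, pd k h x * grad g h x k := by
  unfold gradNormSq gip
  refine sum_congr rfl fun k _ => ?_
  rw [← aux_lower_raise hg hx (fun l => pd l h x) k, sum_mul]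
  refine sum_congr rfl fun j _ => ?_
  change _ = g x k j * grad g h x j * _
  ring

theorem aux_pd_norm {g : (Fin n → ℝ) → Matrix (Fin n) (Fin n) ℝ} {U : Set (Fin n → ℝ)}
    (hU : IsOpen U) (hg : IsRiemannianMetricOn g U) {h : (Fin n → ℝ) → ℝ}
    (hh : ContDiffOn ℝ (⊤ : ℕ∞) h U) {x : Fin n → ℝ} (hx : x ∈ U) (i : Fin n) :
    pd i (gradNormSq g h) x = 2 * ∑ l, hessC g h i l x * grad g h x l := by
  have hd1 := fun k => aux_diff hU (aux_pd_smooth hU hh k) hx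
  have hd2 := fun k => aux_diff hU (aux_grad_smooth hU hg hh k) hx
  rw [aux_pd_congr hU (fun y hy => aux_norm_eq hg h hy) hx,
    aux_pd_sum i fun k => (hd1 k).fun_mul (hd2 k)]
  have h1 : ∀ k, pd i (fun y => pd k h y * grad g h y k) x = pd i (pd k h) x * grad g h x k
      + pd k h x * (∑ l, (g x)⁻¹ k l * hessC g h i l x)
      - pd k h x * ∑ j, christoffel g k i j x * grad g h x j := by
    intro k
    rw [aux_pd_mul i (hd1 k) (hd2 k), ← aux_pd_grad hU hg hh hx]
    ring
  simp only [h1, sum_sub_distrib, sum_add_distrib]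
  have h2 : ∑ k, pd k h x * (∑ l, (g x)⁻¹ k l * hessC g h i l x)
      = ∑ l, hessC g h i l x * grad g h x l := by
    simp only [grad, mul_sum]
    rw [sum_comm]
    refine sum_congr rfl fun a _ => sum_congr rfl fun b _ => ?_
    rw [aux_inv_symm hg hx a b]; ring
  have h3 : ∑ k, pd k h x * ∑ j, christoffel g k i j x * grad g h x j
      = ∑ k, pd i (pd k h) x * grad g h x k - ∑ l, hessC g h i l x * grad g h x l := by
    simp only [hessC, sub_mul, sum_sub_distrib, sub_sub_cancel, mul_sum, sum_mul]
    rw [sum_comm]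
    exact sum_congr rfl fun _ _ => sum_congr rfl fun _ _ => by ring
  rw [h2, h3]
  ring

theorem aux_norm_pos {g : (Fin n → ℝ) → Matrix (Fin n) (Fin n) ℝ} {U : Set (Fin n → ℝ)}
    (hg : IsRiemannianMetricOn g U) {h : (Fin n → ℝ) → ℝ}
    {x : Fin n → ℝ} (hx : x ∈ U) (h0 : grad g h x ≠ 0) : 0 < gradNormSq g h x := by
  have := (hg.2 x hx).dotProduct_mulVec_pos h0
  refine lt_of_lt_of_eq this ?_
  simp only [gradNormSq, gip, dotProduct, Matrix.mulVec, mul_sum]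
  exact sum_congr rfl fun _ _ => sum_congr rfl fun _ _ => by simp; ring

theorem aux_cov_X {g : (Fin n → ℝ) → Matrix (Fin n) (Fin n) ℝ} {U : Set (Fin n → ℝ)}
    (hU : IsOpen U) (hg : IsRiemannianMetricOn g U) {h : (Fin n → ℝ) → ℝ}
    (hh : ContDiffOn ℝ (⊤ : ℕ∞) h U) {x : Fin n → ℝ} (hx : x ∈ U) (k : Fin n) :
    covDeriv g (grad g h) (vecX g h x) x k
      = (2 * gradNormSq g h x)⁻¹ * grad g (gradNormSq g h) x k := by
  rw [aux_cov_grad hU hg hh hx]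
  have h1 : grad g (gradNormSq g h) x k =
      ∑ l, (g x)⁻¹ k l * (2 * ∑ i, hessC g h l i x * grad g h x i) := by
    exact sum_congr rfl fun l _ => by rw [← aux_pd_norm hU hg hh hx]
  rw [h1]
  simp only [vecX, mul_sum]
  rw [sum_comm]
  refine sum_congr rfl fun l _ => sum_congr rfl fun i _ => ?_
  rw [aux_hess_symm hU hg hh hx i l, mul_inv]
  ring

theorem aux_div_congr {g : (Fin n → ℝ) → Matrix (Fin n) (Fin n) ℝ} {U : Set (Fin n → ℝ)}
    (hU : IsOpen U) {V W : (Fin n → ℝ) → Fin n → ℝ} (hVW : ∀ y ∈ U, ∀ k, V y k = W y k)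
    {x : Fin n → ℝ} (hx : x ∈ U) : divVF g V x = divVF g W x := by
  simp only [divVF, covDeriv]
  simp only [fun k i => aux_pd_congr hU (fun y hy => hVW y hy k) hx i, hVW x hx]

theorem aux_div_smul {g : (Fin n → ℝ) → Matrix (Fin n) (Fin n) ℝ}
    {W : (Fin n → ℝ) → Fin n → ℝ} {a : (Fin n → ℝ) → ℝ} {x : Fin n → ℝ}
    (ha : DifferentiableAt ℝ a x) (hW : ∀ k, DifferentiableAt ℝ (fun y => W y k) x) :
    divVF g (fun y k => a y * W y k) x = a x * divVF g W x + ∑ k, pd k a x * W x k := by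
  simp only [divVF, covDeriv]
  rw [mul_sum, ← sum_add_distrib]
  refine sum_congr rfl fun k _ => ?_
  simp only [aux_pd_mul _ ha (hW k), mul_add, mul_sum, sum_add_distrib]
  have e1 : ∑ i, (Pi.single k 1 : Fin n → ℝ) i * (pd i a x * W x k) = pd k a x * W x k := by
    simp [Pi.single_apply]
  rw [e1]
  have e2 : ∀ i, (Pi.single k 1 : Fin n → ℝ) i * (a x * pd i (fun y => W y k) x)
      = a x * ((Pi.single k 1 : Fin n → ℝ) i * pd i (fun y => W y k) x) := fun i => by ring
  have e3 : ∀ i j, christoffel g k i j x * (Pi.single k 1 : Fin n → ℝ) i * (a x * W x j)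
      = a x * (christoffel g k i j x * (Pi.single k 1 : Fin n → ℝ) i * W x j) :=
    fun i j => by ring
  simp only [e2, e3]
  ring

theorem aux_parseval {g : (Fin n → ℝ) → Matrix (Fin n) (Fin n) ℝ} {p : Fin n → ℝ}
    {e : Fin n → Fin n → ℝ}
    (he : ∀ a b, gip g p (e a) (e b) = if a = b then 1 else 0) (w : Fin n → ℝ) :
    ∑ i, (∑ a, e i a * w a) ^ 2 = ∑ k, w k * ∑ l, (g p)⁻¹ k l * w l := by
  have h1 : (Matrix.of e) * (g p * (Matrix.of e)ᵀ) = 1 := by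
    ext a b
    rw [Matrix.one_apply, ← he a b]
    simp only [Matrix.mul_apply, Matrix.of_apply, Matrix.transpose_apply, gip, mul_sum]
    exact sum_congr rfl fun _ _ => sum_congr rfl fun _ _ => by ring
  have h2 : g p * ((Matrix.of e)ᵀ * Matrix.of e) = 1 := by
    rw [← Matrix.mul_assoc]; exact mul_eq_one_comm.mp h1
  rw [Matrix.inv_eq_right_inv h2]
  simp only [Matrix.mul_apply, Matrix.of_apply, Matrix.transpose_apply, sq, sum_mul, mul_sum]
  rw [sum_comm]
  conv_lhs => enter [2, a]; rw [sum_comm]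
  rw [sum_comm]
  exact sum_congr rfl fun _ _ => sum_congr rfl fun _ _ => sum_congr rfl fun _ _ => by ring

end helpers

/-- If `|∇f| ≠ 0` on an open set `U`, `X = ∇f/|∇f|²`, and `{e₁,…,e_n}` is an orthonormal
frame at `p ∈ U`, then at `p`:
`div(∇_X ∇f) = -2 ∑ i, ∇²f(eᵢ, X)² + (|X|²/2) Δ|∇f|²`. -/
theorem div_covDeriv_X_grad {n : ℕ}
    (g : (Fin n → ℝ) → Matrix (Fin n) (Fin n) ℝ)
    (U : Set (Fin n → ℝ)) (hU : IsOpen U) (hg : IsRiemannianMetricOn g U)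
    (f : (Fin n → ℝ) → ℝ) (hf : ContDiffOn ℝ (⊤ : ℕ∞) f U)
    (hgrad : ∀ x ∈ U, grad g f x ≠ 0)
    (p : Fin n → ℝ) (hp : p ∈ U)
    (e : Fin n → Fin n → ℝ)
    (he : ∀ a b, gip g p (e a) (e b) = if a = b then 1 else 0) :
    divVF g (fun y => covDeriv g (grad g f) (vecX g f y) y) p
      = -2 * ∑ i, (hess g f p (e i) (vecX g f p)) ^ 2
        + xNormSq g f p / 2 * lap g (gradNormSq g f) p := by
  have hu := aux_norm_smooth hU hg hf
  have hpos : ∀ x ∈ U, 0 < gradNormSq g f x := fun x hx => aux_norm_pos hg hx (hgrad x hx)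
  have hup := hpos p hp
  have hdu := aux_diff hU hu hp
  have hda : DifferentiableAt ℝ (fun y => (2 * gradNormSq g f y)⁻¹) p :=
    (hdu.const_mul 2).inv (by positivity)
  have hpda : ∀ k, pd k (fun y => (2 * gradNormSq g f y)⁻¹) p
      = -(pd k (gradNormSq g f) p) / (2 * gradNormSq g f p ^ 2) := by
    intro k
    have h1 : pd k (fun y => (2 * gradNormSq g f y) * (2 * gradNormSq g f y)⁻¹) p = 0 := by
      rw [aux_pd_congr hU (b := fun _ => 1)
        (fun y hy => mul_inv_cancel₀ (by have := hpos y hy; positivity)) hp k]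
      simp [pd]
    rw [aux_pd_mul k (hdu.const_mul 2) hda, aux_pd_mul k (differentiableAt_const _) hdu] at h1
    have h2 : pd k (fun _ : Fin n → ℝ => (2 : ℝ)) p = 0 := by simp [pd]
    rw [h2] at h1
    generalize pd k (fun y => (2 * gradNormSq g f y)⁻¹) p = z at *
    field_simp at h1 ⊢
    linarith
  rw [aux_div_congr hU (fun y hy k => aux_cov_X hU hg hf hy k) hp,
    aux_div_smul hda (fun k => aux_diff hU (aux_grad_smooth hU hg hu k) hp),
    aux_div_grad hU hg hu hp]
  have hx : xNormSq g f p = (gradNormSq g f p)⁻¹ := by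
    have : xNormSq g f p = gradNormSq g f p / gradNormSq g f p ^ 2 := by
      conv_rhs => enter [1]; unfold gradNormSq gip
      simp only [xNormSq, gip, vecX, Finset.sum_div]
      exact Finset.sum_congr rfl fun _ _ => Finset.sum_congr rfl fun _ _ => by
        rw [sq, div_eq_mul_inv, div_eq_mul_inv, div_eq_mul_inv, mul_inv]; ring
    rw [this]; field_simp
  have hh : ∀ i, hess g f p (e i) (vecX g f p)
      = (2 * gradNormSq g f p)⁻¹ * ∑ a, e i a * pd a (gradNormSq g f) p := by
    intro i
    simp only [aux_pd_norm hU hg hf hp, hess, vecX, Finset.mul_sum]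
    exact Finset.sum_congr rfl fun _ _ => Finset.sum_congr rfl fun _ _ => by
      rw [mul_inv]; ring
  simp only [hh, mul_pow, ← Finset.mul_sum, hpda, hx]
  rw [aux_parseval he]
  have h4 : ∑ k, -(pd k (gradNormSq g f) p) / (2 * gradNormSq g f p ^ 2)
        * grad g (gradNormSq g f) p k
      = -(2 * gradNormSq g f p ^ 2)⁻¹ *
        ∑ k, pd k (gradNormSq g f) p * ∑ l, (g p)⁻¹ k l * pd l (gradNormSq g f) p := by
    rw [Finset.mul_sum]
    refine Finset.sum_congr rfl fun k _ => ?_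
    change _ = _ * (_ * grad g (gradNormSq g f) p k)
    ring
  rw [h4]
  field_simp
  ring
end

section
/- Let f be a smooth function on a Riemannian manifold M with |∇f| ≠ 0 on an open set U, let X = ∇f/|∇f|², and let (x₁,...,x_n) be coordinates adapted to the level sets of f with ∂₁ = X and ∂₂,...,∂_n orthonormal at a point p, with e₁,...,e_n the unit vectors in the directions of the coordinate vectors. Then at p: Rc(X,X) + |X|⁴⟨∇f, ∇(Δf)⟩ = −2 ∇²f(X,X)² + 2X(∇²f(X,X)) + 2|X|² ∇²f(X,X) Δf − 2|X|⁴ Σ_{i,j=2}^n ∇²f(∂_i,∂_j)² + div(∇_X X) + Σ_{i=1}^n |∇_{e_i} X|². -/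
/-!
We formalize Riemannian geometry on a coordinate chart: a Riemannian metric on an open
subset of `ℝⁿ` is given by a smooth field of positive definite symmetric matrices `g`.
All of the classical objects (Levi-Civita connection via Christoffel symbols, curvature,
Ricci curvature, gradient, Hessian, Laplace–Beltrami operator, divergence, covariant
derivatives of vector fields) are defined below by their standard coordinate formulas.
-/

open scoped BigOperators
open Matrix MeasureTheory

namespace KeyId

lemma sum_split {n : ℕ} [NeZero n] (F : Fin n → ℝ) :
    ∑ i, F i = F 0 + ∑ i ∈ Finset.univ.filter (fun i => i ≠ (0 : Fin n)), F i := by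
  rw [← Finset.add_sum_erase _ _ (Finset.mem_univ (0 : Fin n))]
  congr 2
  ext i; simp

lemma pd_congr {n : ℕ} {U : Set (Fin n → ℝ)} (hU : IsOpen U) {a b : (Fin n → ℝ) → ℝ}
    (h : ∀ y ∈ U, a y = b y) {x : Fin n → ℝ} (hx : x ∈ U) (i : Fin n) :
    pd i a x = pd i b x := by
  unfold pd
  rw [Filter.EventuallyEq.fderiv_eq]
  filter_upwards [hU.mem_nhds hx] with y hy using h y hy

lemma pd_const {n : ℕ} (c : ℝ) (x : Fin n → ℝ) (i : Fin n) :
    pd i (fun _ => c) x = 0 := by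
  simp [pd]

lemma pd_coord {n : ℕ} (k : Fin n) (x : Fin n → ℝ) (i : Fin n) :
    pd i (fun y => y k) x = if i = k then 1 else 0 := by
  unfold pd
  have h : HasFDerivAt (fun y : Fin n → ℝ => y k)
    (ContinuousLinearMap.proj (R := ℝ) (φ := fun _ : Fin n => ℝ) k) x := 
    (ContinuousLinearMap.proj (R := ℝ) (φ := fun _ : Fin n => ℝ) k).hasFDerivAt
  rw [h.fderiv]
  simp [Pi.single_apply, eq_comm]

section
variable {n : ℕ} [NeZero n]
    {g : (Fin n → ℝ) → Matrix (Fin n) (Fin n) ℝ}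
    {U : Set (Fin n → ℝ)} (hU : IsOpen U) (hg : IsRiemannianMetricOn g U)
    (hblock : ∀ x ∈ U, ∀ j, j ≠ 0 → g x 0 j = 0 ∧ g x j 0 = 0)
    {x : Fin n → ℝ} (hx : x ∈ U)

include hg hx in
lemma g_symm (i j : Fin n) : g x i j = g x j i := by
  have := (hg.2 x hx).isHermitian.apply i j
  simpa using this.symm

include hg hx in
lemma w_pos : 0 < g x 0 0 := (hg.2 x hx).diag_pos

include hg hx in
lemma det_unit : IsUnit (g x).det := (hg.2 x hx).det_pos.ne'.isUnit

include hg hblock hx in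
lemma ginv_row (j : Fin n) : (g x)⁻¹ 0 j = if j = 0 then (g x 0 0)⁻¹ else 0 := by
  have h := congrFun (congrFun (Matrix.mul_nonsing_inv (g x) (det_unit hg hx)) 0) j
  rw [Matrix.mul_apply, sum_split, Finset.sum_eq_zero, Matrix.one_apply] at h
  · have hw := (w_pos hg hx).ne'
    split_ifs with hj
    · subst hj
      simp at h
      field_simp
      linarith
    · rw [if_neg (Ne.symm hj)] at h
      simpa [hw] using h
  · intro i hi
    simp at hi
    simp [(hblock x hx i hi).1]

include hg hblock hx in
lemma ginv_col (j : Fin n) : (g x)⁻¹ j 0 = if j = 0 then (g x 0 0)⁻¹ else 0 := by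
  have h := congrFun (congrFun (Matrix.nonsing_inv_mul (g x) (det_unit hg hx)) j) 0
  rw [Matrix.mul_apply, sum_split, Finset.sum_eq_zero, Matrix.one_apply] at h
  · have hw := (w_pos hg hx).ne'
    split_ifs with hj
    · subst hj
      simp at h
      field_simp
      linarith
    · rw [if_neg hj] at h
      simpa [hw] using h
  · intro i hi
    simp at hi
    simp [(hblock x hx i hi).2]

include hU hg hx in
lemma pdg_symm (k i j : Fin n) : pd k (fun y => g y i j) x = pd k (fun y => g y j i) x :=
  pd_congr hU (fun _ hy => g_symm hg hy i j) hx k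

include hU hblock hx in
lemma pdg_row (k j : Fin n) (hj : j ≠ 0) : pd k (fun y => g y 0 j) x = 0 := by
  rw [pd_congr hU (b := fun _ => 0) (fun y hy => (hblock y hy j hj).1) hx k, pd_const]

include hU hblock hx in
lemma pdg_col (k j : Fin n) (hj : j ≠ 0) : pd k (fun y => g y j 0) x = 0 := by
  rw [pd_congr hU (b := fun _ => 0) (fun y hy => (hblock y hy j hj).2) hx k, pd_const]

include hU hg hx in
lemma chr_symm (k i j : Fin n) : christoffel g k i j x = christoffel g k j i x := by
  unfold christoffel
  congr 1
  refine Finset.sum_congr rfl fun l _ => ?_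
  rw [pdg_symm hU hg hx l i j]; ring

include hg hblock hx in
lemma chr_zero (i j : Fin n) : christoffel g 0 i j x = (1/2) * ((g x 0 0)⁻¹ *
    (pd i (fun y => g y j 0) x + pd j (fun y => g y i 0) x - pd 0 (fun y => g y i j) x)) := by
  unfold christoffel
  rw [sum_split, Finset.sum_eq_zero, add_zero]
  · rw [ginv_row hg hblock hx]; simp
  · intro l hl
    simp at hl
    rw [ginv_row hg hblock hx]; simp [hl]

include hU hg hblock hx in
lemma chr_zero_zero : christoffel g 0 0 0 x =
    (1/2) * ((g x 0 0)⁻¹ * pd 0 (fun y => g y 0 0) x) := by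
  rw [chr_zero hg hblock hx]; ring

include hU hg hblock hx in
lemma chr_zero_j (j : Fin n) (hj : j ≠ 0) : christoffel g 0 0 j x =
    (1/2) * ((g x 0 0)⁻¹ * pd j (fun y => g y 0 0) x) := by
  rw [chr_zero hg hblock hx, pdg_col hU hblock hx 0 j hj, pdg_row hU hblock hx 0 j hj]; ring

include hU hg hblock hx in
lemma chr_zero_ij (i j : Fin n) (hi : i ≠ 0) (hj : j ≠ 0) : christoffel g 0 i j x =
    - ((1/2) * ((g x 0 0)⁻¹ * pd 0 (fun y => g y i j) x)) := by
  rw [chr_zero hg hblock hx, pdg_col hU hblock hx i j hj, pdg_col hU hblock hx j i hi]; ring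

include hU hg hblock hx in
lemma chr_k0j (k j : Fin n) (hk : k ≠ 0) (hj : j ≠ 0) : christoffel g k 0 j x =
    (1/2) * ∑ l ∈ Finset.univ.filter (fun i => i ≠ (0 : Fin n)),
      (g x)⁻¹ k l * pd 0 (fun y => g y j l) x := by
  unfold christoffel
  rw [sum_split, ginv_col hg hblock hx, if_neg hk, zero_mul, zero_add]
  congr 1
  refine Finset.sum_congr rfl fun l hl => ?_
  simp at hl
  rw [pdg_row hU hblock hx j l hl, pdg_row hU hblock hx l j hj]; ring

include hU hg hblock hx in
lemma chr_k00 (k : Fin n) (hk : k ≠ 0) : christoffel g k 0 0 x =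
    - ((1/2) * ∑ l ∈ Finset.univ.filter (fun i => i ≠ (0 : Fin n)),
      (g x)⁻¹ k l * pd l (fun y => g y 0 0) x) := by
  unfold christoffel
  rw [sum_split, ginv_col hg hblock hx, if_neg hk, zero_mul, zero_add, ← mul_neg,
    ← Finset.sum_neg_distrib]
  congr 1
  refine Finset.sum_congr rfl fun l hl => ?_
  simp at hl
  rw [pdg_row hU hblock hx 0 l hl]; ring

lemma hessC_coord (i j : Fin n) (x : Fin n → ℝ) :
    hessC g (fun x => x 0) i j x = - christoffel g 0 i j x := by
  unfold hessC
  have : pd j (fun x : Fin n → ℝ => x 0) = fun _ => if j = 0 then 1 else 0 := by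
    funext y; exact pd_coord 0 y j
  rw [this, pd_const]
  simp [pd_coord]

include hg hblock hx in
lemma grad_zero (h : (Fin n → ℝ) → ℝ) : grad g h x 0 = (g x 0 0)⁻¹ * pd 0 h x := by
  unfold grad
  simp [ginv_row hg hblock hx]

include hg hblock hx in
lemma grad_coord : grad g (fun x => x 0) x = Pi.single 0 (g x 0 0)⁻¹ := by
  funext i
  unfold grad
  simp [pd_coord, ginv_col hg hblock hx, Pi.single_apply]

lemma gip_single (a : ℝ) (v : Fin n → ℝ) (hrow : ∀ j, j ≠ 0 → g x 0 j = 0) :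
    gip g x (Pi.single 0 a) v = g x 0 0 * a * v 0 := by
  unfold gip
  have h1 : ∑ i ∈ Finset.univ.filter (fun i => i ≠ (0 : Fin n)),
      ∑ j, g x i j * (Pi.single 0 a : Fin n → ℝ) i * v j = 0 := by
    refine Finset.sum_eq_zero fun i hi => Finset.sum_eq_zero fun j _ => ?_
    simp at hi
    simp [hi]
  have h2 : ∑ j ∈ Finset.univ.filter (fun i => i ≠ (0 : Fin n)),
      g x 0 j * (Pi.single 0 a : Fin n → ℝ) 0 * v j = 0 := by
    refine Finset.sum_eq_zero fun j hj => ?_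
    simp at hj
    simp [hrow j hj]
  rw [sum_split, h1, sum_split, h2]
  simp

include hg hblock hx in
lemma vecX_coord : vecX g (fun x => x 0) x = Pi.single 0 1 := by
  have hw := (w_pos hg hx).ne'
  funext i
  unfold vecX gradNormSq
  rw [grad_coord hg hblock hx, gip_single _ _ (fun j hj => (hblock x hx j hj).1)]
  by_cases hi : i = 0
  · subst hi
    simp [hw]
  · simp [hi]

include hg hblock hx in
lemma xNormSq_coord : xNormSq g (fun x => x 0) x = g x 0 0 := by
  unfold xNormSq
  rw [vecX_coord hg hblock hx, gip_single _ _ (fun j hj => (hblock x hx j hj).1)]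
  simp

lemma hess_coord (i j : Fin n) (x : Fin n → ℝ) :
    hess g (fun x => x 0) x (Pi.single i 1) (Pi.single j 1) = - christoffel g 0 i j x := by
  unfold hess
  simp [hessC_coord, Pi.single_apply]

include hU hg hx in
lemma g_smooth (i j : Fin n) : ContDiffAt ℝ (⊤ : ℕ∞) (fun y => g y i j) x :=
  (hg.1 i j).contDiffAt (hU.mem_nhds hx)

include hU hg hx in
lemma g_diff (i j : Fin n) : DifferentiableAt ℝ (fun y => g y i j) x :=
  (g_smooth hU hg hx i j).differentiableAt (by simp)

include hU hg hx in
lemma pdg_diff (k i j : Fin n) : DifferentiableAt ℝ (pd k (fun y => g y i j)) x := by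
  have h : ContDiffAt ℝ 1 (fderiv ℝ (fun y => g y i j)) x :=
    (g_smooth hU hg hx i j).fderiv_right (by norm_cast)
  exact (h.differentiableAt (by simp)).clm_apply (differentiableAt_const _)

omit [NeZero n] in
lemma det_diff {M : (Fin n → ℝ) → Matrix (Fin n) (Fin n) ℝ} {x : Fin n → ℝ}
    (h : ∀ i j, DifferentiableAt ℝ (fun y => M y i j) x) :
    DifferentiableAt ℝ (fun y => (M y).det) x := by
  simp only [Matrix.det_apply']
  refine DifferentiableAt.fun_sum fun σ _ => ?_
  refine (differentiableAt_const _).mul ?_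
  have key : ∀ s : Finset (Fin n), DifferentiableAt ℝ (fun y => ∏ i ∈ s, M y (σ i) i) x := by
    intro s
    induction s using Finset.induction_on with
    | empty => simp
    | insert a s ha ih =>
      simp only [Finset.prod_insert ha]
      exact (h (σ a) a).mul ih
  exact key Finset.univ

include hU hg hx in
lemma ginv_diff (i j : Fin n) : DifferentiableAt ℝ (fun y => (g y)⁻¹ i j) x := by
  simp only [Matrix.inv_def, Matrix.smul_apply, Matrix.adjugate_apply, Ring.inverse_eq_inv',
    smul_eq_mul]
  refine ((det_diff (g_diff hU hg hx)).inv (det_unit hg hx).ne_zero).mul (det_diff ?_)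
  intro a b
  by_cases h : a = j
  · subst h; simp
  · simpa [Matrix.updateRow_ne h] using g_diff hU hg hx a b

include hU hg hx in
lemma chr_diff (k i j : Fin n) : DifferentiableAt ℝ (christoffel g k i j) x := by
  unfold christoffel
  refine (differentiableAt_const _).mul (DifferentiableAt.fun_sum fun l _ => ?_)
  exact (ginv_diff hU hg hx k l).mul
    (((pdg_diff hU hg hx i j l).add (pdg_diff hU hg hx j i l)).sub (pdg_diff hU hg hx l i j))

/-- trace of the Christoffel symbols over the tangential directions -/
noncomputable def T (g : (Fin n → ℝ) → Matrix (Fin n) (Fin n) ℝ) (x : Fin n → ℝ) : ℝ :=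
  ∑ k ∈ Finset.univ.filter (fun i => i ≠ (0 : Fin n)), christoffel g k k 0 x

include hU hg hblock hx in
lemma lap_coord : lap g (fun x => x 0) x = (T g x - christoffel g 0 0 0 x) * (g x 0 0)⁻¹ := by
  unfold lap
  rw [sum_split]
  have h1 : ∑ j, (g x)⁻¹ 0 j * hessC g (fun x => x 0) 0 j x
      = - christoffel g 0 0 0 x * (g x 0 0)⁻¹ := by
    simp [ginv_row hg hblock hx, hessC_coord]; ring
  rw [h1, T, sub_mul, Finset.sum_mul, sub_eq_neg_add, neg_mul]
  congr 1
  refine Finset.sum_congr rfl fun i hi => ?_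
  simp at hi
  rw [chr_symm hU hg hx, chr_k0j hU hg hblock hx i i hi hi, sum_split, ginv_col hg hblock hx,
    if_neg hi, zero_mul, zero_add, Finset.mul_sum, Finset.sum_mul]
  refine Finset.sum_congr rfl fun j hj => ?_
  simp at hj
  rw [hessC_coord, chr_zero_ij hU hg hblock hx i j hi hj]
  ring

include hU hg hx in
lemma T_diff : DifferentiableAt ℝ (T g) x := by
  unfold T
  exact DifferentiableAt.fun_sum fun k _ => chr_diff hU hg hx k k 0

include hU hg hx in
lemma pd_T (i : Fin n) : pd i (T g) x =
    ∑ k ∈ Finset.univ.filter (fun i => i ≠ (0 : Fin n)), pd i (christoffel g k k 0) x := by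
  unfold pd T
  rw [fderiv_fun_sum fun k _ => chr_diff hU hg hx k k 0]
  simp

include hU hg hblock hx in
lemma pd_w : pd 0 (fun y => g y 0 0) x = 2 * g x 0 0 * christoffel g 0 0 0 x := by
  have hw := (w_pos hg hx).ne'
  rw [chr_zero_zero hU hg hblock hx]; field_simp

include hU hg hblock hx in
lemma pd_lap : g x 0 0 * pd 0 (lap g (fun x => x 0)) x = pd 0 (T g) x
    - pd 0 (christoffel g 0 0 0) x
    - 2 * christoffel g 0 0 0 x * (T g x - christoffel g 0 0 0 x) := by
  have hw := (w_pos hg hx).ne'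
  rw [pd_congr hU (fun y hy => lap_coord hU hg hblock hy) hx 0]
  have e1 := (T_diff hU hg hx).hasFDerivAt.sub (chr_diff hU hg hx 0 0 0).hasFDerivAt
  have e2 := (hasDerivAt_inv hw).comp_hasFDerivAt x (g_diff hU hg hx 0 0).hasFDerivAt
  have e3 := (e1.mul e2).fderiv
  have e4 := pd_w hU hg hblock hx
  have e5 : pd 0 (fun y => (T g y - christoffel g 0 0 0 y) * (g y 0 0)⁻¹) x =
      (T g x - christoffel g 0 0 0 x) * (-(g x 0 0 ^ 2)⁻¹ * pd 0 (fun y => g y 0 0) x)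
      + (g x 0 0)⁻¹ * (pd 0 (T g) x - pd 0 (christoffel g 0 0 0) x) := by
    unfold pd
    erw [e3]
    simp
  rw [e5, e4]
  field_simp
  ring

include hU hg hblock hx in
lemma cov_XX (k : Fin n) : covDeriv g (vecX g (fun x => x 0)) (vecX g (fun x => x 0) x) x k
    = christoffel g k 0 0 x := by
  unfold covDeriv
  rw [vecX_coord hg hblock hx]
  have : pd 0 (fun y => vecX g (fun x => x 0) y k) x = 0 := by
    rw [pd_congr hU (b := fun _ => (Pi.single 0 1 : Fin n → ℝ) k)
      (fun y hy => by rw [vecX_coord hg hblock hy]) hx 0, pd_const]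
  simp [Pi.single_apply, this]

include hU hg hblock hx in
lemma cov_single (v : Fin n → ℝ) (k : Fin n) : covDeriv g (vecX g (fun x => x 0)) v x k
    = ∑ i, christoffel g k i 0 x * v i := by
  unfold covDeriv
  rw [vecX_coord hg hblock hx]
  have (i : Fin n) : pd i (fun y => vecX g (fun x => x 0) y k) x = 0 := by
    rw [pd_congr hU (b := fun _ => (Pi.single 0 1 : Fin n → ℝ) k)
      (fun y hy => by rw [vecX_coord hg hblock hy]) hx i, pd_const]
  simp [Pi.single_apply, this]

include hU hg hblock hx in
lemma div_cov : divVF g (fun y => covDeriv g (vecX g (fun x => x 0))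
      (vecX g (fun x => x 0) y) y) x
    = ∑ k, (pd k (christoffel g k 0 0) x
      + ∑ m, christoffel g k k m x * christoffel g m 0 0 x) := by
  unfold divVF
  refine Finset.sum_congr rfl fun k _ => ?_
  change (∑ i, (Pi.single k 1 : Fin n → ℝ) i * pd i (fun y => covDeriv g
      (vecX g (fun x => x 0)) (vecX g (fun x => x 0) y) y k) x)
    + ∑ i, ∑ j, christoffel g k i j x * (Pi.single k 1 : Fin n → ℝ) i * covDeriv g
      (vecX g (fun x => x 0)) (vecX g (fun x => x 0) x) x j = _
  simp only [cov_XX hU hg hblock hx]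
  rw [Finset.sum_eq_single k, Finset.sum_eq_single k]
  · simp only [Pi.single_eq_same, one_mul, mul_one]
    congr 1
    exact pd_congr hU (fun y hy => cov_XX hU hg hblock hy k) hx k
  all_goals simp +contextual [Pi.single_apply]

include hU hg hblock hx in
lemma ricci_eq : ricci g x (Pi.single 0 1) (Pi.single 0 1) =
    ∑ k, (pd k (christoffel g k 0 0) x
      + ∑ m, christoffel g k k m x * christoffel g m 0 0 x)
    - (pd 0 (christoffel g 0 0 0) x + pd 0 (T g) x)
    - ∑ k, ∑ m, christoffel g k 0 m x * christoffel g m k 0 x := by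
  rw [pd_T hU hg hx, ← sum_split (fun k => pd 0 (christoffel g k k 0) x)]
  unfold ricci riemann
  simp [Pi.single_apply, Finset.sum_add_distrib, Finset.sum_sub_distrib]
  ring

end

section
variable {n : ℕ} [NeZero n]
    {g : (Fin n → ℝ) → Matrix (Fin n) (Fin n) ℝ}
    {U : Set (Fin n → ℝ)} (hU : IsOpen U) (hg : IsRiemannianMetricOn g U)
    (hblock : ∀ x ∈ U, ∀ j, j ≠ 0 → g x 0 j = 0 ∧ g x j 0 = 0)
    {p : Fin n → ℝ} (hp : p ∈ U)
    (horth : ∀ i j, i ≠ 0 → j ≠ 0 → g p i j = if i = j then 1 else 0)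

include hg hblock hp horth in
lemma ginv_p (k j : Fin n) (hk : k ≠ 0) : (g p)⁻¹ k j = if k = j then 1 else 0 := by
  have h := congrFun (congrFun (Matrix.mul_nonsing_inv (g p) (det_unit hg hp)) k) j
  rw [Matrix.mul_apply, sum_split, (hblock p hp k hk).2, zero_mul, zero_add,
    Finset.sum_eq_single k, horth k k hk hk, Matrix.one_apply] at h
  · simpa using h
  · intro b hb hbk
    simp at hb
    rw [horth k b hk hb, if_neg hbk.symm, zero_mul]
  · intro h; simp [hk] at h

include hU hg hblock hp horth in
lemma chr_p_k00 (k : Fin n) (hk : k ≠ 0) :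
    christoffel g k 0 0 p = - g p 0 0 * christoffel g 0 0 k p := by
  have hw := (w_pos hg hp).ne'
  rw [chr_k00 hU hg hblock hp k hk, chr_zero_j hU hg hblock hp k hk]
  rw [Finset.sum_eq_single k]
  · simp [ginv_p hg hblock hp horth k k hk]; field_simp
  · intro b _ hb
    simp [ginv_p hg hblock hp horth k b hk, hb.symm]
  · intro h; simp [hk] at h

include hU hg hblock hp horth in
lemma chr_p_k0j (k j : Fin n) (hk : k ≠ 0) (hj : j ≠ 0) :
    christoffel g k 0 j p = - g p 0 0 * christoffel g 0 k j p := by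
  have hw := (w_pos hg hp).ne'
  rw [chr_k0j hU hg hblock hp k j hk hj, chr_zero_ij hU hg hblock hp k j hk hj,
    pdg_symm hU hg hp 0 k j]
  rw [Finset.sum_eq_single k]
  · simp [ginv_p hg hblock hp horth k k hk]; field_simp
  · intro b _ hb
    simp [ginv_p hg hblock hp horth k b hk, hb.symm]
  · intro h; simp [hk] at h

include hblock hp horth in
lemma gip_p (v : Fin n → ℝ) : gip g p v v = g p 0 0 * v 0 ^ 2
    + ∑ k ∈ Finset.univ.filter (fun i => i ≠ (0 : Fin n)), v k ^ 2 := by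
  unfold gip
  rw [sum_split, sum_split, Finset.sum_eq_zero, add_zero]
  · congr 1
    · ring
    refine Finset.sum_congr rfl fun k hk => ?_
    simp at hk
    rw [sum_split, (hblock p hp k hk).2, Finset.sum_eq_single k]
    · rw [horth k k hk hk]; simp; ring
    · intro b hb hbk
      simp at hb
      rw [horth k b hk hb, if_neg hbk.symm]; ring
    · intro h; simp [hk] at h
  · intro j hj
    simp at hj
    rw [(hblock p hp j hj).1]; ring

end

end KeyId

/-- In coordinates `(x₁,…,x_n)` adapted to the level sets of `f` (so `x₁ = f` and
`∂₁ = X = ∇f/|∇f|²`), with `∂₂,…,∂_n` orthonormal at `p`, and with `e₁ = X/|X|`,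
`eᵢ = ∂ᵢ` (`i ≥ 2`) the unit vectors in the directions of the coordinate vectors,
one has at `p`:
`Rc(X,X) + |X|⁴ ⟨∇f, ∇(Δf)⟩ = -2 ∇²f(X,X)² + 2 X(∇²f(X,X)) + 2|X|² ∇²f(X,X) Δf`
`- 2|X|⁴ ∑_{i,j=2}^n ∇²f(∂ᵢ,∂ⱼ)² + div(∇_X X) + ∑_{i=1}^n |∇_{eᵢ} X|²`. -/
theorem key_identity_adapted_coords {n : ℕ} [NeZero n]
    (g : (Fin n → ℝ) → Matrix (Fin n) (Fin n) ℝ)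
    (U : Set (Fin n → ℝ)) (hU : IsOpen U) (hg : IsRiemannianMetricOn g U)
    (f : (Fin n → ℝ) → ℝ) (hf : f = fun x => x 0)
    (hgrad : ∀ x ∈ U, grad g f x ≠ 0)
    (hblock : ∀ x ∈ U, ∀ j, j ≠ 0 → g x 0 j = 0 ∧ g x j 0 = 0)
    (p : Fin n → ℝ) (hp : p ∈ U)
    (horth : ∀ i j, i ≠ 0 → j ≠ 0 → g p i j = if i = j then 1 else 0)
    (e : Fin n → Fin n → ℝ)
    (he : e = fun i => if i = (0 : Fin n)
      then (Real.sqrt (xNormSq g f p))⁻¹ • vecX g f p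
      else Pi.single i 1) :
    ricci g p (vecX g f p) (vecX g f p)
        + (xNormSq g f p) ^ 2 * gip g p (grad g f p) (grad g (lap g f) p)
      = -2 * (hess g f p (vecX g f p) (vecX g f p)) ^ 2
        + 2 * dirDeriv (vecX g f p) (fun y => hess g f y (vecX g f y) (vecX g f y)) p
        + 2 * xNormSq g f p * hess g f p (vecX g f p) (vecX g f p) * lap g f p
        - 2 * (xNormSq g f p) ^ 2 *
            ∑ i ∈ Finset.univ.filter (fun i => i ≠ (0 : Fin n)),
              ∑ j ∈ Finset.univ.filter (fun j => j ≠ (0 : Fin n)),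
                (hess g f p (Pi.single i 1) (Pi.single j 1)) ^ 2
        + divVF g (fun y => covDeriv g (vecX g f) (vecX g f y) y) p
        + ∑ i, gip g p (covDeriv g (vecX g f) (e i) p)
            (covDeriv g (vecX g f) (e i) p) := by
  have hw := KeyId.w_pos hg hp
  have hw' := hw.ne'
  subst hf
  have hrow : ∀ j, j ≠ 0 → g p 0 j = 0 := fun j hj => (hblock p hp j hj).1
  have hgip : g p 0 0 ^ 2 * gip g p (grad g (fun x => x 0) p)
      (grad g (lap g (fun x => x 0)) p) = pd 0 (KeyId.T g) p
      - pd 0 (christoffel g 0 0 0) p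
      - 2 * christoffel g 0 0 0 p * (KeyId.T g p - christoffel g 0 0 0 p) := by
    rw [← KeyId.pd_lap hU hg hblock hp, KeyId.grad_coord hg hblock hp,
      KeyId.gip_single _ _ hrow, KeyId.grad_zero hg hblock hp]
    field_simp
  have hdir : dirDeriv (Pi.single 0 1) (fun y => hess g (fun x => x 0) y
      (vecX g (fun x => x 0) y) (vecX g (fun x => x 0) y)) p
      = - pd 0 (christoffel g 0 0 0) p := by
    change pd 0 _ p = _
    rw [KeyId.pd_congr hU (b := fun y => - christoffel g 0 0 0 y)
      (fun y hy => by rw [KeyId.vecX_coord hg hblock hy, KeyId.hess_coord]) hp 0]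
    unfold pd
    rw [fderiv_fun_neg]; rfl
  have hE0 : gip g p (covDeriv g (vecX g (fun x => x 0)) (e 0) p)
      (covDeriv g (vecX g (fun x => x 0)) (e 0) p)
      = christoffel g 0 0 0 p ^ 2 + g p 0 0 *
        ∑ k ∈ Finset.univ.filter (fun i => i ≠ (0 : Fin n)), christoffel g 0 0 k p ^ 2 := by
    have h0 : ∀ k, covDeriv g (vecX g (fun x => x 0)) (e 0) p k
        = christoffel g k 0 0 p * (Real.sqrt (g p 0 0))⁻¹ := by
      intro k
      rw [KeyId.cov_single hU hg hblock hp, he]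
      simp [KeyId.vecX_coord hg hblock hp, KeyId.xNormSq_coord hg hblock hp, Pi.single_apply]
    have hs : ((Real.sqrt (g p 0 0))⁻¹) ^ 2 = (g p 0 0)⁻¹ := by
      rw [inv_pow, Real.sq_sqrt hw.le]
    rw [KeyId.gip_p hblock hp horth]
    simp only [h0, mul_pow, hs]
    rw [Finset.mul_sum]
    congr 1
    · field_simp
    refine Finset.sum_congr rfl fun k hk => ?_
    simp at hk
    rw [KeyId.chr_p_k00 hU hg hblock hp horth k hk]
    field_simp
  have hEi : ∀ i, i ≠ 0 → gip g p (covDeriv g (vecX g (fun x => x 0)) (e i) p)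
      (covDeriv g (vecX g (fun x => x 0)) (e i) p)
      = g p 0 0 * christoffel g 0 0 i p ^ 2 + g p 0 0 ^ 2 *
        ∑ k ∈ Finset.univ.filter (fun i => i ≠ (0 : Fin n)), christoffel g 0 i k p ^ 2 := by
    intro i hi
    have h0 : ∀ k, covDeriv g (vecX g (fun x => x 0)) (e i) p k
        = christoffel g k 0 i p := by
      intro k
      rw [KeyId.cov_single hU hg hblock hp, he, KeyId.chr_symm hU hg hp k 0 i]
      simp [hi, Pi.single_apply]
    rw [KeyId.gip_p hblock hp horth]
    simp only [h0]
    rw [Finset.mul_sum]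
    congr 1
    refine Finset.sum_congr rfl fun k hk => ?_
    simp at hk
    rw [KeyId.chr_p_k0j hU hg hblock hp horth k i hk hi, KeyId.chr_symm hU hg hp 0 k i]
    ring
  have hQ0 : ∑ m, christoffel g 0 0 m p * christoffel g m 0 0 p
      = christoffel g 0 0 0 p ^ 2 - g p 0 0 *
        ∑ k ∈ Finset.univ.filter (fun i => i ≠ (0 : Fin n)), christoffel g 0 0 k p ^ 2 := by
    rw [KeyId.sum_split, Finset.mul_sum, sub_eq_add_neg, ← Finset.sum_neg_distrib]
    congr 1
    · ring
    refine Finset.sum_congr rfl fun k hk => ?_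
    simp at hk
    rw [KeyId.chr_p_k00 hU hg hblock hp horth k hk]
    ring
  have hQi : ∀ i, i ≠ 0 → ∑ m, christoffel g i 0 m p * christoffel g m i 0 p
      = - g p 0 0 * christoffel g 0 0 i p ^ 2 + g p 0 0 ^ 2 *
        ∑ k ∈ Finset.univ.filter (fun i => i ≠ (0 : Fin n)), christoffel g 0 i k p ^ 2 := by
    intro i hi
    rw [KeyId.sum_split, Finset.mul_sum]
    congr 1
    · rw [KeyId.chr_p_k00 hU hg hblock hp horth i hi, KeyId.chr_symm hU hg hp 0 i 0]
      ring
    refine Finset.sum_congr rfl fun k hk => ?_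
    simp at hk
    rw [KeyId.chr_symm hU hg hp k i 0, KeyId.chr_p_k0j hU hg hblock hp horth k i hk hi,
      KeyId.chr_p_k0j hU hg hblock hp horth i k hi hk, KeyId.chr_symm hU hg hp 0 k i]
    ring
  have hE : ∑ i, gip g p (covDeriv g (vecX g (fun x => x 0)) (e i) p)
      (covDeriv g (vecX g (fun x => x 0)) (e i) p)
      = christoffel g 0 0 0 p ^ 2 + 2 * (g p 0 0 *
        ∑ k ∈ Finset.univ.filter (fun i => i ≠ (0 : Fin n)), christoffel g 0 0 k p ^ 2)
        + g p 0 0 ^ 2 * ∑ i ∈ Finset.univ.filter (fun i => i ≠ (0 : Fin n)),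
          ∑ k ∈ Finset.univ.filter (fun i => i ≠ (0 : Fin n)), christoffel g 0 i k p ^ 2 := by
    rw [KeyId.sum_split, hE0, Finset.sum_congr rfl
      (fun i hi => hEi i (by simpa using hi)), Finset.sum_add_distrib, ← Finset.mul_sum,
      ← Finset.mul_sum]
    ring
  have hQ : ∑ k, ∑ m, christoffel g k 0 m p * christoffel g m k 0 p
      = christoffel g 0 0 0 p ^ 2 - 2 * (g p 0 0 *
        ∑ k ∈ Finset.univ.filter (fun i => i ≠ (0 : Fin n)), christoffel g 0 0 k p ^ 2)
        + g p 0 0 ^ 2 * ∑ i ∈ Finset.univ.filter (fun i => i ≠ (0 : Fin n)),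
          ∑ k ∈ Finset.univ.filter (fun i => i ≠ (0 : Fin n)), christoffel g 0 i k p ^ 2 := by
    rw [KeyId.sum_split, hQ0, Finset.sum_congr rfl
      (fun i hi => hQi i (by simpa using hi)), Finset.sum_add_distrib, ← Finset.mul_sum,
      ← Finset.mul_sum]
    ring
  rw [hE, KeyId.div_cov hU hg hblock hp, KeyId.vecX_coord hg hblock hp,
    KeyId.xNormSq_coord hg hblock hp, hgip, hdir, KeyId.ricci_eq hU hg hblock hp, hQ,
    KeyId.lap_coord hU hg hblock hp]
  simp only [KeyId.hess_coord, neg_sq]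
  field_simp
  ring
end
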